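/- arXiv:2305.12362 — 5 statements merged into one kernel-verified Lean document; each statement's English description precedes it below -/
import Mathlib

section
/- Let g : ℂ → ℂ be smooth (infinitely differentiable over ℝ) with compact support and let m ≥ 1 be a natural number. Write ∂_z^{(j)}g for the j-fold iterate of the Wirtinger derivative ∂/∂z applied to g (each iterate is again smooth with compact support). Then the function z ↦ (∂_z^{(m−1)}g)(z)/z is integrable on ℂ, and the radial principal value of g(z)/z^m equals its integral divided by (m−1)!: lim_{ε→0⁺} ∫_{{z : ℂ | ε ≤ ‖z‖}} g(z)/z^m dA(z) = (1/(m−1)!) · ∫_ℂ (∂_z^{(m−1)}g)(z)/z dA(z). -/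
open MeasureTheory Filter Topology

/-- The Wirtinger derivative `∂f/∂z` of `f : ℂ → ℂ`, computed from the real Fréchet
derivative. -/
noncomputable def wirtingerDZ (f : ℂ → ℂ) : ℂ → ℂ :=
  fun z => (1 / 2 : ℂ) * (fderiv ℝ f z 1 - Complex.I * fderiv ℝ f z Complex.I)

lemma wdz_contDiff {g : ℂ → ℂ} (hg : ContDiff ℝ (⊤ : ℕ∞) g) :
    ContDiff ℝ (⊤ : ℕ∞) (wirtingerDZ g) := by
  have h : ContDiff ℝ (⊤ : ℕ∞) (fderiv ℝ g) := hg.fderiv_right (m := (⊤ : ℕ∞)) (by simp)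
  unfold wirtingerDZ
  exact contDiff_const.mul ((h.clm_apply contDiff_const).sub
    (contDiff_const.mul (h.clm_apply contDiff_const)))

lemma wdz_tsupport (g : ℂ → ℂ) : tsupport (wirtingerDZ g) ⊆ tsupport g := by
  refine (closure_mono ?_).trans (closure_minimal (support_fderiv_subset ℝ (f := g)) isClosed_closure)
  intro z hz
  simp only [Function.mem_support] at hz ⊢
  intro h
  apply hz
  simp [wirtingerDZ, h]

lemma wdz_compact {g : ℂ → ℂ} (hg : HasCompactSupport g) : HasCompactSupport (wirtingerDZ g) :=
  hg.mono' ((subset_tsupport _).trans (wdz_tsupport g))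

/-- Angular Fourier coefficient of `g` on the circle of radius `r`. -/
noncomputable def angCoeff (g : ℂ → ℂ) (k : ℕ) (r : ℝ) : ℂ :=
  ∫ θ in (-Real.pi)..Real.pi, g (r * Complex.exp (θ * Complex.I)) *
    Complex.exp (-(θ * Complex.I)) ^ k

lemma angCoeff_hasDerivAt {g : ℂ → ℂ} (hg : ContDiff ℝ (⊤ : ℕ∞) g) (hgc : HasCompactSupport g)
    (k : ℕ) (r : ℝ) :
    HasDerivAt (angCoeff g k) (∫ θ in (-Real.pi)..Real.pi,
      fderiv ℝ g (r * Complex.exp (θ * Complex.I)) (Complex.exp (θ * Complex.I)) *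
        Complex.exp (-(θ * Complex.I)) ^ k) r := by
  have hc : Continuous g := hg.continuous
  have hf : Continuous (fderiv ℝ g) := hg.continuous_fderiv (by simp)
  obtain ⟨C, hC⟩ := hf.bounded_above_of_compact_support (hgc.fderiv (𝕜 := ℝ))
  have hn : ∀ θ : ℝ, ‖Complex.exp (-(θ * Complex.I))‖ = 1 := fun θ => by
    have := Complex.norm_exp_ofReal_mul_I (-θ)
    simpa using this
  refine (intervalIntegral.hasDerivAt_integral_of_dominated_loc_of_deriv_le
    (F := fun (r : ℝ) (θ : ℝ) => g (r * Complex.exp (θ * Complex.I)) *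
      Complex.exp (-(θ * Complex.I)) ^ k)
    (F' := fun (r : ℝ) (θ : ℝ) => fderiv ℝ g (r * Complex.exp (θ * Complex.I))
      (Complex.exp (θ * Complex.I)) * Complex.exp (-(θ * Complex.I)) ^ k)
    (s := Set.univ) (bound := fun _ => C) Filter.univ_mem ?_ ?_ ?_ ?_ ?_ ?_).2
  · refine Eventually.of_forall fun x => Continuous.aestronglyMeasurable ?_
    fun_prop
  · apply Continuous.intervalIntegrable
    fun_prop
  · apply Continuous.aestronglyMeasurable
    exact ((hf.comp (by fun_prop)).clm_apply (by fun_prop)).mul (by fun_prop)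
  · refine Eventually.of_forall fun θ _ x _ => ?_
    rw [norm_mul, norm_pow, hn, one_pow, mul_one]
    refine (ContinuousLinearMap.le_opNorm _ _).trans ?_
    rw [Complex.norm_exp_ofReal_mul_I, mul_one]
    exact hC _
  · exact intervalIntegrable_const
  · refine Eventually.of_forall fun θ _ x _ => ?_
    have h1 : HasDerivAt (fun x : ℝ => (x : ℂ) * Complex.exp (θ * Complex.I))
        (Complex.exp (θ * Complex.I)) x := by
      simpa using (Complex.ofRealCLM.hasDerivAt (x := x)).mul_const (Complex.exp (θ * Complex.I))
    have h2 := ((hg.differentiable (by simp)).differentiableAt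
      (x := (x : ℂ) * Complex.exp (θ * Complex.I))).hasFDerivAt.comp_hasDerivAt x h1
    exact h2.mul_const _

lemma angCoeff_continuous {g : ℂ → ℂ} (hg : ContDiff ℝ (⊤ : ℕ∞) g) (hgc : HasCompactSupport g)
    (k : ℕ) : Continuous (angCoeff g k) :=
  continuous_iff_continuousAt.2 fun r => (angCoeff_hasDerivAt hg hgc k r).continuousAt

lemma exp_hasDerivAt (θ : ℝ) : HasDerivAt (fun θ : ℝ => Complex.exp (θ * Complex.I))
    (Complex.I * Complex.exp (θ * Complex.I)) θ := by
  have h := ((Complex.ofRealCLM.hasDerivAt (x := θ)).mul_const Complex.I).cexp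
  simpa [mul_comm] using h

lemma exp_neg_hasDerivAt (θ : ℝ) : HasDerivAt (fun θ : ℝ => Complex.exp (-(θ * Complex.I)))
    (-Complex.I * Complex.exp (-(θ * Complex.I))) θ := by
  have h := ((Complex.ofRealCLM.hasDerivAt (x := θ)).mul_const Complex.I).neg.cexp
  simpa [mul_comm] using h

lemma ang_parts {g : ℂ → ℂ} (hg : ContDiff ℝ (⊤ : ℕ∞) g) (k : ℕ) (r : ℝ) :
    (∫ θ in (-Real.pi)..Real.pi,
      (r * fderiv ℝ g (r * Complex.exp (θ * Complex.I)) (Complex.I * Complex.exp (θ * Complex.I))) *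
        Complex.exp (-(θ * Complex.I)) ^ k) = Complex.I * k * angCoeff g k r := by
  have hc : Continuous g := hg.continuous
  have hf : Continuous (fderiv ℝ g) := hg.continuous_fderiv (by simp)
  have hder : ∀ θ : ℝ, HasDerivAt (fun θ : ℝ => g (r * Complex.exp (θ * Complex.I)) *
      Complex.exp (-(θ * Complex.I)) ^ k)
      ((r * fderiv ℝ g (r * Complex.exp (θ * Complex.I))
        (Complex.I * Complex.exp (θ * Complex.I))) * Complex.exp (-(θ * Complex.I)) ^ k
        - Complex.I * k * (g (r * Complex.exp (θ * Complex.I)) *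
      Complex.exp (-(θ * Complex.I)) ^ k)) θ := by
    intro θ
    have h1 := (exp_hasDerivAt θ).const_mul (r : ℂ)
    have h2 := ((hg.differentiable (by simp)).differentiableAt
      (x := (r : ℂ) * Complex.exp (θ * Complex.I))).hasFDerivAt.comp_hasDerivAt θ h1
    have h3 := h2.mul ((exp_neg_hasDerivAt θ).pow k)
    refine h3.congr_deriv ?_
    have : fderiv ℝ g (r * Complex.exp (θ * Complex.I))
        (r * (Complex.I * Complex.exp (θ * Complex.I))) =
        r * fderiv ℝ g (r * Complex.exp (θ * Complex.I))
          (Complex.I * Complex.exp (θ * Complex.I)) := by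
      rw [← Complex.real_smul (x := r) (z := Complex.I * _), map_smul, Complex.real_smul]
    rw [this]
    rcases k with _ | k
    · simp
    · simp only [Function.comp, Nat.add_sub_cancel, Pi.pow_apply]
      push_cast
      ring
  have hcont1 : Continuous fun θ : ℝ => (r * fderiv ℝ g (r * Complex.exp (θ * Complex.I))
        (Complex.I * Complex.exp (θ * Complex.I))) * Complex.exp (-(θ * Complex.I)) ^ k :=
    (continuous_const.mul ((hf.comp (by fun_prop)).clm_apply (by fun_prop))).mul (by fun_prop)
  have hcont2 : Continuous fun θ : ℝ => Complex.I * k * (g (r * Complex.exp (θ * Complex.I)) *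
      Complex.exp (-(θ * Complex.I)) ^ k) := by fun_prop
  have h := intervalIntegral.integral_eq_sub_of_hasDerivAt (a := -Real.pi) (b := Real.pi)
    (fun θ _ => hder θ) ((hcont1.sub hcont2).intervalIntegrable _ _)
  rw [intervalIntegral.integral_sub (hcont1.intervalIntegrable _ _)
    (hcont2.intervalIntegrable _ _), intervalIntegral.integral_const_mul] at h
  have e1 : Complex.exp (((-Real.pi : ℝ) : ℂ) * Complex.I) = -1 := by
    push_cast
    rw [neg_mul, Complex.exp_neg, Complex.exp_pi_mul_I]; norm_num
  have e2 : Complex.exp (-(((-Real.pi : ℝ) : ℂ) * Complex.I)) = -1 := by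
    push_cast
    rw [neg_mul, neg_neg, Complex.exp_pi_mul_I]
  have e3 : Complex.exp (-((Real.pi : ℂ) * Complex.I)) = -1 := by
    rw [Complex.exp_neg, Complex.exp_pi_mul_I]; norm_num
  rw [e1, e2, e3, Complex.exp_pi_mul_I, sub_self, sub_eq_zero] at h
  exact h

lemma wdz_polar (g : ℂ → ℂ) (z : ℂ) (θ : ℝ) :
    2 * wirtingerDZ g z = Complex.exp (-(θ * Complex.I)) *
      (fderiv ℝ g z (Complex.exp (θ * Complex.I)) -
        Complex.I * fderiv ℝ g z (Complex.I * Complex.exp (θ * Complex.I))) := by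
  have hL : ∀ w : ℂ, fderiv ℝ g z w = w.re * fderiv ℝ g z 1 + w.im * fderiv ℝ g z Complex.I := by
    intro w
    conv_lhs => rw [show w = w.re • (1 : ℂ) + w.im • Complex.I by
      simp [Complex.re_add_im]]
    rw [map_add, map_smul, map_smul, Complex.real_smul, Complex.real_smul]
  have hinv : Complex.exp (-(θ * Complex.I)) * Complex.exp (θ * Complex.I) = 1 := by
    rw [← Complex.exp_add]; simp
  set w := Complex.exp (θ * Complex.I) with hw
  set v := Complex.exp (-(θ * Complex.I))
  have hre : (w.re : ℂ) + w.im * Complex.I = w := Complex.re_add_im w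
  rw [hL w, hL (Complex.I * w)]
  simp only [wirtingerDZ, Complex.mul_re, Complex.mul_im, Complex.I_re, Complex.I_im]
  push_cast
  have hI := Complex.I_mul_I
  set a := fderiv ℝ g z 1
  set b := fderiv ℝ g z Complex.I
  linear_combination (-(a - Complex.I * b)) * hinv - v * (a - Complex.I * b) * hre
    - v * b * w.im * hI

lemma wdz_coeff {g : ℂ → ℂ} (hg : ContDiff ℝ (⊤ : ℕ∞) g) (hgc : HasCompactSupport g)
    (k : ℕ) (r : ℝ) :
    ∃ D, HasDerivAt (angCoeff g (k + 1)) D r ∧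
      2 * r * angCoeff (wirtingerDZ g) k r = r * D + (k + 1) * angCoeff g (k + 1) r := by
  refine ⟨_, angCoeff_hasDerivAt hg hgc (k + 1) r, ?_⟩
  have hf : Continuous (fderiv ℝ g) := hg.continuous_fderiv (by simp)
  have hp := ang_parts hg (k + 1) r
  have hcont1 : Continuous fun θ : ℝ => (r * fderiv ℝ g (r * Complex.exp (θ * Complex.I))
        (Complex.I * Complex.exp (θ * Complex.I))) * Complex.exp (-(θ * Complex.I)) ^ (k + 1) :=
    (continuous_const.mul ((hf.comp (by fun_prop)).clm_apply (by fun_prop))).mul (by fun_prop)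
  have hcont2 : Continuous fun θ : ℝ => fderiv ℝ g (r * Complex.exp (θ * Complex.I))
        (Complex.exp (θ * Complex.I)) * Complex.exp (-(θ * Complex.I)) ^ (k + 1) :=
    ((hf.comp (by fun_prop)).clm_apply (by fun_prop)).mul (by fun_prop)
  have h1 : ((k : ℂ) + 1) * angCoeff g (k + 1) r = -Complex.I * (Complex.I * ((k + 1 : ℕ) : ℂ) *
      angCoeff g (k + 1) r) := by
    push_cast
    linear_combination (((k : ℂ) + 1) * angCoeff g (k + 1) r) * Complex.I_mul_I
  have i1 : IntervalIntegrable (fun θ : ℝ => (r : ℂ) * (fderiv ℝ g (r * Complex.exp (θ * Complex.I))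
        (Complex.exp (θ * Complex.I)) * Complex.exp (-(θ * Complex.I)) ^ (k + 1))) volume
        (-Real.pi) Real.pi := (continuous_const.mul hcont2).intervalIntegrable _ _
  have i2 : IntervalIntegrable (fun θ : ℝ => -Complex.I *
      ((r * fderiv ℝ g (r * Complex.exp (θ * Complex.I))
        (Complex.I * Complex.exp (θ * Complex.I))) * Complex.exp (-(θ * Complex.I)) ^ (k + 1)))
        volume (-Real.pi) Real.pi := (continuous_const.mul hcont1).intervalIntegrable _ _
  rw [h1, ← hp, ← intervalIntegral.integral_const_mul, ← intervalIntegral.integral_const_mul,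
    ← intervalIntegral.integral_add i1 i2, angCoeff,
    ← intervalIntegral.integral_const_mul]
  congr 1
  ext θ
  have := wdz_polar g (r * Complex.exp (θ * Complex.I)) θ
  linear_combination (r * Complex.exp (-(θ * Complex.I)) ^ k) * this

lemma pow_coeff_hasDerivAt {g : ℂ → ℂ} (hg : ContDiff ℝ (⊤ : ℕ∞) g) (hgc : HasCompactSupport g)
    (k : ℕ) (r : ℝ) :
    HasDerivAt (fun r : ℝ => (r : ℂ) ^ (k + 1) * angCoeff g (k + 1) r)
      (2 * (r : ℂ) ^ (k + 1) * angCoeff (wirtingerDZ g) k r) r := by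
  obtain ⟨D, hD, h⟩ := wdz_coeff hg hgc k r
  have h1 : HasDerivAt (fun r : ℝ => (r : ℂ)) 1 r := by
    exact (Complex.ofRealCLM.hasDerivAt (x := r)).congr_deriv (by simp)
  have h2 := (h1.pow (k + 1)).mul hD
  refine h2.congr_deriv ?_
  simp only [Nat.add_sub_cancel, Pi.pow_apply]
  push_cast
  linear_combination (-(r : ℂ) ^ k) * h

lemma angCoeff_bound (k : ℕ) : ∀ {g : ℂ → ℂ}, ContDiff ℝ (⊤ : ℕ∞) g → HasCompactSupport g →
    ∃ C : ℝ, 0 ≤ C ∧ ∀ r : ℝ, 0 ≤ r → ‖angCoeff g k r‖ ≤ C * r ^ k := by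
  induction k with
  | zero =>
    intro g hg hgc
    obtain ⟨C, hC⟩ := hg.continuous.bounded_above_of_compact_support hgc
    have hC0 : 0 ≤ C := (norm_nonneg _).trans (hC 0)
    refine ⟨C * |Real.pi - -Real.pi|, by positivity, fun r _ => ?_⟩
    simp only [pow_zero, mul_one, angCoeff]
    exact intervalIntegral.norm_integral_le_of_norm_le_const fun θ _ => hC _
  | succ k ih =>
    intro g hg hgc
    obtain ⟨C, hC0, hC⟩ := ih (wdz_contDiff hg) (wdz_compact hgc)
    refine ⟨2 * C, by positivity, fun r hr => ?_⟩
    have hcA := angCoeff_continuous (wdz_contDiff hg) (wdz_compact hgc) k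
    have hcont : Continuous fun r : ℝ => 2 * (r : ℂ) ^ (k + 1) * angCoeff (wirtingerDZ g) k r := by
      fun_prop
    have h := intervalIntegral.integral_eq_sub_of_hasDerivAt (a := 0) (b := r)
      (fun x _ => pow_coeff_hasDerivAt hg hgc k x) (hcont.intervalIntegrable _ _)
    have hb := intervalIntegral.norm_integral_le_of_norm_le_const (a := 0) (b := r)
      (f := fun r : ℝ => 2 * (r : ℂ) ^ (k + 1) * angCoeff (wirtingerDZ g) k r)
      (C := 2 * r ^ (k + 1) * (C * r ^ k)) (fun x hx => by
        rw [Set.uIoc_of_le hr] at hx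
        have hx0 := hx.1.le
        rw [norm_mul, norm_mul, norm_pow, Complex.norm_real, Real.norm_of_nonneg hx0]
        have h1 := hC x hx0
        have hx2 := hx.2
        have h3 : ‖(2 : ℂ)‖ = 2 := by simp
        rw [h3]
        have h2 : C * x ^ k ≤ C * r ^ k := by gcongr
        have h4 := h1.trans h2
        gcongr)
    rw [h] at hb
    simp only [Complex.ofReal_zero, zero_pow (Nat.succ_ne_zero k), zero_mul, sub_zero, norm_mul,
      norm_pow, Complex.norm_real, Real.norm_of_nonneg hr, abs_of_nonneg hr] at hb
    rcases hr.eq_or_lt with rfl | hr'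
    · have hA : HasDerivAt (angCoeff g (k + 1)) _ 0 := angCoeff_hasDerivAt hg hgc (k+1) 0
      obtain ⟨D, _, h0⟩ := wdz_coeff hg hgc k 0
      have h5 : ((k : ℂ) + 1) ≠ 0 := by exact_mod_cast Nat.succ_ne_zero k
      have h6 : angCoeff g (k + 1) 0 = 0 := by
        simpa [h5] using h0
      simp [h6]
    · have hp : 0 < r ^ (k + 1) := by positivity
      refine le_of_mul_le_mul_left ?_ hp
      calc _ ≤ _ := hb
        _ = _ := by ring

/-- one-dimensional step -/
lemma radial_step {g : ℂ → ℂ} (hg : ContDiff ℝ (⊤ : ℕ∞) g) (hgc : HasCompactSupport g)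
    (m : ℕ) {ε R : ℝ} (hε : 0 < ε) (hεR : ε ≤ R) (hR : ∀ z : ℂ, R ≤ ‖z‖ → g z = 0) :
    (m : ℂ) * (∫ r in ε..R, (r : ℂ) / (r : ℂ) ^ (m + 1) * angCoeff g (m + 1) r) =
      (∫ r in ε..R, (r : ℂ) / (r : ℂ) ^ m * angCoeff (wirtingerDZ g) m r) +
        1 / 2 * ((ε : ℂ) / (ε : ℂ) ^ m * angCoeff g (m + 1) ε) := by
  have hcA := angCoeff_continuous hg hgc (m + 1)
  have hcB := angCoeff_continuous (wdz_contDiff hg) (wdz_compact hgc) m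
  have hne : ∀ r ∈ Set.uIcc ε R, (r : ℂ) ≠ 0 := fun r hr => by
    rw [Set.uIcc_of_le hεR] at hr
    exact_mod_cast (hε.trans_le hr.1).ne'
  have hder : ∀ r ∈ Set.uIcc ε R, HasDerivAt (fun r : ℝ => ((r : ℂ) ^ (m + 1) *
      angCoeff g (m + 1) r) / (r : ℂ) ^ (2 * m))
      (2 * ((r : ℂ) / (r : ℂ) ^ m * angCoeff (wirtingerDZ g) m r) -
        2 * m * ((r : ℂ) / (r : ℂ) ^ (m + 1) * angCoeff g (m + 1) r)) r := by
    intro r hr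
    have h0 := hne r hr
    have h1 : HasDerivAt (fun r : ℝ => (r : ℂ)) 1 r := by
      exact (Complex.ofRealCLM.hasDerivAt (x := r)).congr_deriv (by simp)
    have h2 := (pow_coeff_hasDerivAt hg hgc m r).div (h1.pow (2 * m)) (pow_ne_zero _ h0)
    refine h2.congr_deriv ?_
    simp only [Pi.pow_apply]
    rcases m with _ | m
    · simp
      ring
    · rw [show 2 * (m + 1) - 1 = 2 * m + 1 by omega]
      push_cast
      field_simp
      ring
  have hc1 : ContinuousOn (fun r : ℝ => (r : ℂ) / (r : ℂ) ^ m * angCoeff (wirtingerDZ g) m r)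
      (Set.uIcc ε R) :=
    (ContinuousOn.div (by fun_prop) (by fun_prop) fun r hr => pow_ne_zero _ (hne r hr)).mul
      hcB.continuousOn
  have hc2 : ContinuousOn (fun r : ℝ => (r : ℂ) / (r : ℂ) ^ (m + 1) * angCoeff g (m + 1) r)
      (Set.uIcc ε R) :=
    (ContinuousOn.div (by fun_prop) (by fun_prop) fun r hr => pow_ne_zero _ (hne r hr)).mul
      hcA.continuousOn
  have i1 : IntervalIntegrable (fun r : ℝ => 2 * ((r : ℂ) / (r : ℂ) ^ m *
      angCoeff (wirtingerDZ g) m r)) volume ε R := hc1.intervalIntegrable.const_mul (2 : ℂ)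
  have i2 : IntervalIntegrable (fun r : ℝ => 2 * m * ((r : ℂ) / (r : ℂ) ^ (m + 1) *
      angCoeff g (m + 1) r)) volume ε R := hc2.intervalIntegrable.const_mul (2 * m : ℂ)
  have h := intervalIntegral.integral_eq_sub_of_hasDerivAt hder (i1.sub i2)
  rw [intervalIntegral.integral_sub i1 i2, intervalIntegral.integral_const_mul,
    intervalIntegral.integral_const_mul] at h
  have hAR : angCoeff g (m + 1) R = 0 := by
    unfold angCoeff
    rw [← intervalIntegral.integral_zero (a := -Real.pi) (b := Real.pi) (μ := volume)]
    congr 1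
    ext θ
    rw [hR, zero_mul]
    rw [norm_mul, Complex.norm_exp_ofReal_mul_I, mul_one, Complex.norm_real]
    exact le_abs_self R
  have hε0 : (ε : ℂ) ≠ 0 := by exact_mod_cast hε.ne'
  have hee : (ε : ℂ) ^ (m + 1) * angCoeff g (m + 1) ε / (ε : ℂ) ^ (2 * m) =
      (ε : ℂ) / (ε : ℂ) ^ m * angCoeff g (m + 1) ε := by
    field_simp
    try ring
  rw [hAR, hee] at h
  simp only [mul_zero, zero_div] at h
  linear_combination (-1 / 2) * h

lemma polar_formula {g : ℂ → ℂ} (hg : Continuous g)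
    (m : ℕ) {ε R : ℝ} (hε : 0 < ε) (hεR : ε ≤ R) (hR : ∀ z : ℂ, R ≤ ‖z‖ → g z = 0) :
    (∫ z in {z : ℂ | ε ≤ ‖z‖}, g z / z ^ m) =
      ∫ r in ε..R, (r : ℂ) / (r : ℂ) ^ m * angCoeff g m r := by
  have hms : MeasurableSet {z : ℂ | ε ≤ ‖z‖} := (isClosed_le continuous_const continuous_norm).measurableSet
  rw [← integral_indicator hms, ← Complex.integral_comp_polarCoord_symm]
  set K : ℝ × ℝ → ℂ := fun p => (p.1 : ℂ) / (p.1 : ℂ) ^ m *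
    (g (p.1 * Complex.exp (p.2 * Complex.I)) * Complex.exp (-(p.2 * Complex.I)) ^ m) with hK
  have hfun : ∀ p ∈ polarCoord.target, p.1 • ({z : ℂ | ε ≤ ‖z‖}.indicator (fun z => g z / z ^ m)
      (Complex.polarCoord.symm p)) = (Set.Icc ε R ×ˢ (Set.univ : Set ℝ)).indicator K p := by
    rintro ⟨r, θ⟩ hp
    have hr : 0 < r := hp.1
    have hz : Complex.polarCoord.symm (r, θ) = r * Complex.exp (θ * Complex.I) := by
      rw [Complex.polarCoord_symm_apply, Complex.exp_mul_I]
      push_cast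
      rfl
    have hnz : ‖(r : ℂ) * Complex.exp (θ * Complex.I)‖ = r := by
      rw [norm_mul, Complex.norm_exp_ofReal_mul_I, mul_one, Complex.norm_real,
        Real.norm_of_nonneg hr.le]
    rw [hz]
    by_cases h1 : ε ≤ r
    · rw [Set.indicator_of_mem (by simpa only [Set.mem_ofPred_eq, hnz] using h1)]
      have hval : r • (g (r * Complex.exp (θ * Complex.I)) /
          (r * Complex.exp (θ * Complex.I)) ^ m) = K (r, θ) := by
        simp only [hK, Complex.real_smul, Complex.exp_neg, mul_pow, inv_pow]
        have := Complex.exp_ne_zero (θ * Complex.I)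
        have hr0 : (r : ℂ) ≠ 0 := by exact_mod_cast hr.ne'
        field_simp
      rw [hval]
      by_cases h2 : r ≤ R
      · rw [Set.indicator_of_mem]
        exact ⟨⟨h1, h2⟩, trivial⟩
      · rw [Set.indicator_of_notMem (fun h => h2 h.1.2)]
        simp only [hK]
        rw [hR _ (by rw [hnz]; exact (not_le.1 h2).le)]
        simp
    · rw [Set.indicator_of_notMem (by simpa only [Set.mem_ofPred_eq, hnz] using h1),
        Set.indicator_of_notMem (fun h => h1 h.1.1), smul_zero]
  rw [setIntegral_congr_fun polarCoord.open_target.measurableSet hfun,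
    setIntegral_indicator (measurableSet_Icc.prod MeasurableSet.univ)]
  have hset : polarCoord.target ∩ Set.Icc ε R ×ˢ (Set.univ : Set ℝ) =
      Set.Icc ε R ×ˢ Set.Ioo (-Real.pi) Real.pi := by
    ext ⟨r, θ⟩
    simp only [polarCoord_target, Set.mem_inter_iff, Set.mem_prod, Set.mem_Ioi, Set.mem_univ,
      and_true]
    constructor
    · rintro ⟨⟨_, h⟩, h'⟩; exact ⟨h', h⟩
    · rintro ⟨h', h⟩; exact ⟨⟨hε.trans_le h'.1, h⟩, h'⟩
  have hint : IntegrableOn K (Set.Icc ε R ×ˢ Set.Icc (-Real.pi) Real.pi) := by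
    apply ContinuousOn.integrableOn_compact (isCompact_Icc.prod isCompact_Icc)
    refine ContinuousOn.mul (ContinuousOn.div (by fun_prop) (by fun_prop) ?_)
      (Continuous.continuousOn (by fun_prop))
    rintro ⟨r, θ⟩ h
    have : (r : ℂ) ≠ 0 := by exact_mod_cast (hε.trans_le h.1.1).ne'
    exact pow_ne_zero _ this
  rw [hset, Measure.volume_eq_prod, setIntegral_prod K
    (hint.mono_set (Set.prod_mono le_rfl Set.Ioo_subset_Icc_self)),
    intervalIntegral.integral_of_le hεR, integral_Icc_eq_integral_Ioc]
  congr 1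
  ext r
  rw [angCoeff, intervalIntegral.integral_of_le (by linarith [Real.pi_pos]),
    integral_Ioc_eq_integral_Ioo, ← integral_const_mul]

lemma integrable_div_self {g : ℂ → ℂ} (hg : Continuous g) (hgc : HasCompactSupport g) :
    Integrable (fun z : ℂ => g z / z) := by
  obtain ⟨C, hC⟩ := hg.bounded_above_of_compact_support hgc
  obtain ⟨R, hR⟩ := hgc.isCompact.isBounded.subset_ball (0 : ℂ)
  have h1 : IntegrableOn (fun z : ℂ => ‖z‖⁻¹) (Metric.ball 0 R) := by
    rw [integrableOn_fun_norm_addHaar volume (f := fun x : ℝ => x⁻¹)]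
    have : IntegrableOn (fun _ : ℝ => (1 : ℝ)) (Set.Ioo 0 R) := by simp
    refine this.congr_fun (fun x hx => ?_) measurableSet_Ioo
    have hx0 : x ≠ 0 := hx.1.ne'
    simp [Complex.finrank_real_complex, hx0]
  have h2 : IntegrableOn (fun z : ℂ => g z / z) (Metric.ball 0 R) := by
    refine (h1.const_mul C).mono' ?_ (Eventually.of_forall fun z => ?_)
    · exact (hg.measurable.div measurable_id).aestronglyMeasurable
    · rw [norm_div, div_eq_mul_inv]
      gcongr
      exact hC z
  rw [← integrableOn_iff_integrable_of_support_subset (s := Metric.ball 0 R)]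
  · exact h2
  · intro z hz
    apply hR
    apply subset_tsupport
    simp only [Function.mem_support] at hz ⊢
    intro h
    simp [h] at hz

lemma base_case {g : ℂ → ℂ} (hg : Continuous g) (hgc : HasCompactSupport g) :
    Tendsto (fun ε : ℝ => ∫ z in {z : ℂ | ε ≤ ‖z‖}, g z / z) (𝓝[>] (0 : ℝ))
      (𝓝 (∫ z : ℂ, g z / z)) := by
  have hms : ∀ ε : ℝ, MeasurableSet {z : ℂ | ε ≤ ‖z‖} := fun ε =>
    (isClosed_le continuous_const continuous_norm).measurableSet
  have hi := integrable_div_self hg hgc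
  simp_rw [← integral_indicator (hms _)]
  refine tendsto_integral_filter_of_dominated_convergence (fun z => ‖g z / z‖) ?_ ?_ hi.norm ?_
  · exact Eventually.of_forall fun ε => hi.aestronglyMeasurable.indicator (hms ε)
  · exact Eventually.of_forall fun ε => Eventually.of_forall fun z => norm_indicator_le_norm_self _ _
  · refine Eventually.of_forall fun z => ?_
    rcases eq_or_ne z 0 with rfl | hz
    · refine tendsto_const_nhds.congr fun ε => ?_
      by_cases h : (0 : ℂ) ∈ {z : ℂ | ε ≤ ‖z‖} <;> simp [Set.indicator]
    · refine tendsto_const_nhds.congr' ?_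
      have : Set.Iio ‖z‖ ∈ 𝓝 (0 : ℝ) := Iio_mem_nhds (norm_pos_iff.2 hz)
      filter_upwards [mem_nhdsWithin_of_mem_nhds this] with ε hε
      rw [Set.indicator_of_mem]
      exact le_of_lt (Set.mem_Iio.1 hε)

lemma pv_main (n : ℕ) : ∀ {g : ℂ → ℂ}, ContDiff ℝ (⊤ : ℕ∞) g → HasCompactSupport g →
    Integrable (fun z : ℂ => (wirtingerDZ^[n] g) z / z) ∧
    Tendsto (fun ε : ℝ => ∫ z in {z : ℂ | ε ≤ ‖z‖}, g z / z ^ (n + 1))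
      (𝓝[>] (0 : ℝ))
      (𝓝 ((1 / (Nat.factorial n : ℂ)) * ∫ z : ℂ, (wirtingerDZ^[n] g) z / z)) := by
  induction n with
  | zero =>
    intro g hg hgc
    refine ⟨integrable_div_self hg.continuous hgc, ?_⟩
    simpa using base_case hg.continuous hgc
  | succ n ih =>
    intro g hg hgc
    obtain ⟨h1, h2⟩ := ih (wdz_contDiff hg) (wdz_compact hgc)
    simp only [Function.iterate_succ, Function.comp]
    refine ⟨h1, ?_⟩
    obtain ⟨R, hR⟩ := hgc.isCompact.isBounded.subset_ball (0 : ℂ)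
    have hz1 : ∀ z : ℂ, max R 1 ≤ ‖z‖ → g z = 0 := fun z hz => by
      by_contra h
      have := hR (subset_tsupport g h)
      rw [mem_ball_zero_iff] at this
      exact absurd ((le_max_left _ _).trans hz) (not_le.2 this)
    have hz2 : ∀ z : ℂ, max R 1 ≤ ‖z‖ → wirtingerDZ g z = 0 := fun z hz => by
      by_contra h
      have := hR (wdz_tsupport g (subset_tsupport _ h))
      rw [mem_ball_zero_iff] at this
      exact absurd ((le_max_left _ _).trans hz) (not_le.2 this)
    obtain ⟨C, hC0, hC⟩ := angCoeff_bound (n + 1 + 1) hg hgc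
    have herr : Tendsto (fun ε : ℝ => 1 / 2 * ((ε : ℂ) / (ε : ℂ) ^ (n + 1) *
        angCoeff g (n + 1 + 1) ε)) (𝓝[>] (0 : ℝ)) (𝓝 0) := by
      have hlim : Tendsto (fun ε : ℝ => C * ε ^ 2) (𝓝[>] (0 : ℝ)) (𝓝 0) := by
        have : Continuous fun ε : ℝ => C * ε ^ 2 := by fun_prop
        have h := this.tendsto 0
        simp only [ne_eq, OfNat.ofNat_ne_zero, not_false_eq_true, zero_pow, mul_zero] at h
        exact h.mono_left nhdsWithin_le_nhds
      refine squeeze_zero_norm' ?_ hlim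
      filter_upwards [self_mem_nhdsWithin] with ε hε
      have hε : 0 < ε := hε
      rw [norm_mul, norm_mul, norm_div (ε : ℂ), norm_pow, Complex.norm_real, Real.norm_of_nonneg hε.le]
      have h3 : ‖(1 / 2 : ℂ)‖ ≤ 1 := by norm_num
      calc ‖(1 / 2 : ℂ)‖ * (ε / ε ^ (n + 1) * ‖angCoeff g (n + 1 + 1) ε‖)
          ≤ 1 * (ε / ε ^ (n + 1) * (C * ε ^ (n + 1 + 1))) := by
            have := hC ε hε.le
            gcongr
        _ = C * ε ^ 2 := by
            field_simp
            try ring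
    have hn : ((n : ℂ) + 1) ≠ 0 := by exact_mod_cast Nat.succ_ne_zero n
    have hsum := ((h2.add herr).const_mul (1 / ((n : ℂ) + 1)))
    have hlimeq : (1 / ((n : ℂ) + 1)) * (1 / (Nat.factorial n : ℂ) *
        (∫ z : ℂ, (wirtingerDZ^[n] (wirtingerDZ g)) z / z) + 0) =
        1 / (Nat.factorial (n + 1) : ℂ) * ∫ z : ℂ, (wirtingerDZ^[n] (wirtingerDZ g)) z / z := by
      rw [Nat.factorial_succ]
      push_cast
      have : (Nat.factorial n : ℂ) ≠ 0 := by exact_mod_cast Nat.factorial_ne_zero n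
      field_simp
      try ring
    rw [hlimeq] at hsum
    refine hsum.congr' ?_
    have h01 : Set.Iio (1 : ℝ) ∈ 𝓝 (0 : ℝ) := Iio_mem_nhds one_pos
    filter_upwards [self_mem_nhdsWithin, mem_nhdsWithin_of_mem_nhds h01] with ε hε hε1
    have hεR : ε ≤ max R 1 := (le_of_lt (Set.mem_Iio.1 hε1)).trans (le_max_right _ _)
    have hs := radial_step hg hgc (n + 1) hε hεR hz1
    rw [polar_formula hg.continuous _ hε hεR hz1,
      polar_formula (wdz_contDiff hg).continuous _ hε hεR hz2, ← hs]
    push_cast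
    field_simp

/-- For `g : ℂ → ℂ` smooth with compact support and `m ≥ 1`, the function
`z ↦ (∂_z^{(m-1)} g)(z) / z` is integrable on `ℂ` and the radial principal value of
`g z / z ^ m` equals `(1/(m-1)!) ∫_ℂ (∂_z^{(m-1)} g)(z) / z dA(z)`. -/
theorem stmt_1 (g : ℂ → ℂ) (hg : ContDiff ℝ (⊤ : ℕ∞) g) (hgc : HasCompactSupport g)
    (m : ℕ) (hm : 1 ≤ m) :
    Integrable (fun z : ℂ => (wirtingerDZ^[m - 1] g) z / z) ∧
    Tendsto (fun ε : ℝ => ∫ z in {z : ℂ | ε ≤ ‖z‖}, g z / z ^ m)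
      (𝓝[>] (0 : ℝ))
      (𝓝 ((1 / (Nat.factorial (m - 1) : ℂ)) *
        ∫ z : ℂ, (wirtingerDZ^[m - 1] g) z / z)) := by
  obtain ⟨n, rfl⟩ : ∃ n, m = n + 1 := ⟨m - 1, by omega⟩
  exact pv_main n hg hgc
end

section
/- Let g : ℂ → ℂ be smooth (infinitely differentiable over ℝ) with compact support and let m ≥ 1 be a natural number. Let h : ℂ → ℂ be given on ℂ∖{0} by h(z) = g(z)/z^m. Then the radial principal value of the Wirtinger derivative ∂h/∂z vanishes: the integrals ∫_{{z : ℂ | ε ≤ ‖z‖}} (∂h/∂z)(z) dA(z) converge to 0 as ε → 0⁺. -/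
open MeasureTheory Filter Topology

noncomputable def wirtBar (f : ℂ → ℂ) : ℂ → ℂ :=
  fun z => (1 / 2 : ℂ) * (fderiv ℝ f z 1 + Complex.I * fderiv ℝ f z Complex.I)

lemma wDZ_smooth (g : ℂ → ℂ) (hg : ContDiff ℝ (⊤ : ℕ∞) g) :
    ContDiff ℝ (⊤ : ℕ∞) (wirtingerDZ g) := by
  have h1 : ContDiff ℝ (⊤ : ℕ∞) (fderiv ℝ g) := hg.fderiv_right (by simp)
  unfold wirtingerDZ
  fun_prop

lemma wBar_smooth (g : ℂ → ℂ) (hg : ContDiff ℝ (⊤ : ℕ∞) g) :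
    ContDiff ℝ (⊤ : ℕ∞) (wirtBar g) := by
  have h1 : ContDiff ℝ (⊤ : ℕ∞) (fderiv ℝ g) := hg.fderiv_right (by simp)
  unfold wirtBar
  fun_prop

lemma lin_decomp (L : ℂ →L[ℝ] ℂ) (v : ℂ) : L v = v.re * L 1 + v.im * L Complex.I := by
  have : v = v.re • (1:ℂ) + v.im • Complex.I := by simp
  conv_lhs => rw [this]
  rw [map_add, map_smul, map_smul]; simp

lemma wirt_decomp (g : ℂ → ℂ) (z v : ℂ) :
    fderiv ℝ g z v = v * wirtingerDZ g z + (starRingEnd ℂ v) * wirtBar g z := by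
  rw [lin_decomp, wirtingerDZ, wirtBar]
  generalize fderiv ℝ g z 1 = a
  generalize fderiv ℝ g z Complex.I = b
  have hv : v = v.re + v.im * Complex.I := by simp
  have hc : starRingEnd ℂ v = v.re - v.im * Complex.I := by
    apply Complex.ext <;> simp
  rw [hc]
  generalize v.re = x at *
  generalize v.im = y at *
  subst hv
  linear_combination ((y:ℂ) * b) * Complex.I_sq

/-- Polar coordinates. -/
noncomputable def pE (r θ : ℝ) : ℂ := r * Complex.exp (θ * Complex.I)

noncomputable def fc (g : ℂ → ℂ) (n : ℕ) (r : ℝ) : ℂ :=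
  ∫ θ in (-Real.pi)..Real.pi, g (pE r θ) * Complex.exp (-(n * (θ * Complex.I)))

lemma exp_deriv (n : ℕ) (θ : ℝ) : HasDerivAt
    (fun θ : ℝ => Complex.exp (-(n * ((θ : ℂ) * Complex.I))))
    (Complex.exp (-(n * (θ * Complex.I))) * (-(n * (1 * Complex.I)))) θ := by
  exact ((((Complex.ofRealCLM.hasDerivAt (x := θ)).mul_const Complex.I).const_mul (n:ℂ)).neg).cexp

lemma pE_deriv (r θ : ℝ) : HasDerivAt (fun θ : ℝ => pE r θ) (Complex.I * pE r θ) θ := by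
  have := (((Complex.ofRealCLM.hasDerivAt (x := θ)).mul_const Complex.I).cexp).const_mul (r:ℂ)
  convert! this using 1
  simp [pE]; ring

lemma pE_pi (r : ℝ) : pE r Real.pi = pE r (-Real.pi) := by
  simp [pE, Complex.exp_pi_mul_I, Complex.exp_neg]

lemma exp_pi (n : ℕ) : Complex.exp (-(n * ((Real.pi : ℂ) * Complex.I))) =
    Complex.exp (-(n * (((-Real.pi : ℝ) : ℂ) * Complex.I))) := by
  rw [Complex.exp_neg, Complex.exp_nat_mul, Complex.exp_pi_mul_I]
  have : (-(n * (((-Real.pi : ℝ) : ℂ) * Complex.I))) = n * ((Real.pi : ℂ) * Complex.I) := by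
    push_cast; ring
  rw [this, Complex.exp_nat_mul, Complex.exp_pi_mul_I, ← inv_pow]
  norm_num

lemma fc_step (g : ℂ → ℂ) (hg : ContDiff ℝ (⊤ : ℕ∞) g) (n : ℕ) (r : ℝ) :
    ((n:ℂ) + 1) * fc g (n + 1) r = r * (fc (wirtingerDZ g) n r - fc (wirtBar g) (n + 2) r) := by
  have hd : ∀ θ : ℝ, HasDerivAt
      (fun θ : ℝ => g (pE r θ) * Complex.exp (-((n + 1 : ℕ) * ((θ:ℂ) * Complex.I))))
      (Complex.I * (r * (wirtingerDZ g (pE r θ) * Complex.exp (-(n * ((θ:ℂ) * Complex.I)))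
        - wirtBar g (pE r θ) * Complex.exp (-((n + 2 : ℕ) * ((θ:ℂ) * Complex.I))))
        - ((n:ℂ) + 1) * (g (pE r θ) * Complex.exp (-((n + 1 : ℕ) * ((θ:ℂ) * Complex.I)))))) θ := by
    intro θ
    have h1 := ((hg.differentiable (by simp)).differentiableAt (x := pE r θ)).hasFDerivAt.comp_hasDerivAt
      θ (pE_deriv r θ)
    have h2 := h1.mul (exp_deriv (n + 1) θ)
    convert! h2 using 1
    rw [wirt_decomp]
    have hc : starRingEnd ℂ (Complex.I * pE r θ) = -Complex.I * (r * Complex.exp (-(θ * Complex.I))) := by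
      simp [pE, ← Complex.exp_conj]
    rw [hc]
    have e1 : Complex.exp (-(n * ((θ:ℂ) * Complex.I))) = Complex.exp (θ * Complex.I) *
      Complex.exp (-((n + 1 : ℕ) * ((θ:ℂ) * Complex.I))) := by
      rw [← Complex.exp_add]; congr 1; push_cast; ring
    have e2 : Complex.exp (-((n + 2 : ℕ) * ((θ:ℂ) * Complex.I))) = Complex.exp (-(θ * Complex.I)) *
      Complex.exp (-((n + 1 : ℕ) * ((θ:ℂ) * Complex.I))) := by
      rw [← Complex.exp_add]; congr 1; push_cast; ring
    rw [e1, e2]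
    simp only [Function.comp, pE]
    push_cast
    ring
  have c0 := hg.continuous
  have c1 := (wDZ_smooth g hg).continuous
  have c2 := (wBar_smooth g hg).continuous
  have cp : Continuous (pE r) := by unfold pE; fun_prop
  have hi := intervalIntegral.integral_eq_sub_of_hasDerivAt (a := -Real.pi) (b := Real.pi)
    (fun θ _ => hd θ) (Continuous.intervalIntegrable (by fun_prop) _ _)
  rw [pE_pi, exp_pi, sub_self, intervalIntegral.integral_const_mul, intervalIntegral.integral_sub,
    intervalIntegral.integral_const_mul, intervalIntegral.integral_const_mul,
    intervalIntegral.integral_sub] at hi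
  · have := (mul_eq_zero.1 hi).resolve_left Complex.I_ne_zero
    unfold fc
    exact (sub_eq_zero.1 this).symm
  all_goals exact Continuous.intervalIntegrable (by fun_prop) _ _

lemma fc_bound (k : ℕ) : ∀ (j : ℕ) (g : ℂ → ℂ), ContDiff ℝ (⊤ : ℕ∞) g →
    ∃ C : ℝ, ∀ r : ℝ, 0 < r → r ≤ 1 → ‖fc g (k + j) r‖ ≤ C * r ^ k := by
  induction k with
  | zero =>
    intro j g hg
    obtain ⟨C, hC⟩ := (isCompact_closedBall (0:ℂ) 1).exists_bound_of_continuousOn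
      hg.continuous.continuousOn
    refine ⟨C * |Real.pi - -Real.pi|, fun r h0 h1 => ?_⟩
    rw [pow_zero, mul_one]
    apply intervalIntegral.norm_integral_le_of_norm_le_const
    intro θ _
    have he : ‖Complex.exp (-(((0 + j : ℕ) : ℂ) * ((θ:ℂ) * Complex.I)))‖ = 1 := by
      rw [Complex.norm_exp]; simp
    rw [norm_mul, he, mul_one]
    apply hC
    simp [pE, Complex.norm_exp_ofReal_mul_I, abs_of_pos h0, h1]
  | succ k ih =>
    intro j g hg
    obtain ⟨C1, h1⟩ := ih j _ (wDZ_smooth g hg)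
    obtain ⟨C2, h2⟩ := ih (j + 2) _ (wBar_smooth g hg)
    refine ⟨C1 + C2, fun r h0 hr => ?_⟩
    have hs := fc_step g hg (k + j) r
    have e : k + 1 + j = k + j + 1 := by ring
    rw [e]
    have hn := congrArg norm hs
    rw [norm_mul, norm_mul] at hn
    have hk : (1:ℝ) ≤ ‖((k + j : ℕ) : ℂ) + 1‖ := by
      have : ((k + j : ℕ) : ℂ) + 1 = ((k + j + 1 : ℕ) : ℂ) := by push_cast; ring
      rw [this, Complex.norm_natCast]; push_cast
      have : (0:ℝ) ≤ k := by positivity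
      have : (0:ℝ) ≤ j := by positivity
      linarith
    calc ‖fc g (k + j + 1) r‖ ≤ ‖((k + j : ℕ) : ℂ) + 1‖ * ‖fc g (k + j + 1) r‖ :=
          le_mul_of_one_le_left (norm_nonneg _) hk
      _ = r * ‖fc (wirtingerDZ g) (k + j) r - fc (wirtBar g) (k + j + 2) r‖ := by
          rw [hn]; simp [abs_of_pos h0]
      _ ≤ r * (C1 * r ^ k + C2 * r ^ k) := by
          gcongr
          exact (norm_sub_le _ _).trans (add_le_add (h1 r h0 hr) (h2 r h0 hr))
      _ = _ := by ring

lemma pE_smooth : ContDiff ℝ (⊤ : ℕ∞) (fun p : ℝ × ℝ => pE p.1 p.2) := by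
  have h1 : ContDiff ℝ (⊤ : ℕ∞) (fun x : ℝ => (x : ℂ)) := Complex.ofRealCLM.contDiff
  have h2 : ContDiff ℝ (⊤ : ℕ∞) Complex.exp := Complex.contDiff_exp
  unfold pE
  fun_prop

lemma pE_ne (r θ : ℝ) (hr : 0 < r) : pE r θ ≠ 0 := by
  simp [pE, hr.ne', Complex.exp_ne_zero]

lemma pE_norm (r θ : ℝ) (hr : 0 < r) : ‖pE r θ‖ = r := by
  simp [pE, Complex.norm_exp_ofReal_mul_I, abs_of_pos hr]

lemma pE_deriv_r (r θ : ℝ) :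
    HasDerivAt (fun r : ℝ => pE r θ) (Complex.exp (θ * Complex.I)) r := by
  have := (Complex.ofRealCLM.hasDerivAt (x := r)).mul_const (Complex.exp (θ * Complex.I))
  convert! this using 1
  simp

noncomputable def fA (h : ℂ → ℂ) (p : ℝ × ℝ) : ℂ :=
  p.1 * Complex.exp (-(p.2 * Complex.I)) * h (pE p.1 p.2)

noncomputable def fB (h : ℂ → ℂ) (p : ℝ × ℝ) : ℂ :=
  -Complex.I * Complex.exp (-(p.2 * Complex.I)) * h (pE p.1 p.2)

lemma fA_smooth (h : ℂ → ℂ) (hs : ∀ z, z ≠ 0 → ContDiffAt ℝ (⊤ : ℕ∞) h z) (p : ℝ × ℝ)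
    (hp : 0 < p.1) : ContDiffAt ℝ (⊤ : ℕ∞) (fA h) p := by
  have h1 : ContDiff ℝ (⊤ : ℕ∞) (fun x : ℝ => (x : ℂ)) := Complex.ofRealCLM.contDiff
  have h2 : ContDiff ℝ (⊤ : ℕ∞) Complex.exp := Complex.contDiff_exp
  have h3 : ContDiffAt ℝ (⊤ : ℕ∞) (fun p : ℝ × ℝ => h (pE p.1 p.2)) p :=
    ContDiffAt.comp (f := fun p : ℝ × ℝ => pE p.1 p.2) p (hs _ (pE_ne p.1 p.2 hp)) pE_smooth.contDiffAt
  unfold fA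
  refine ContDiffAt.mul (ContDiff.contDiffAt ?_) h3
  fun_prop

lemma fB_smooth (h : ℂ → ℂ) (hs : ∀ z, z ≠ 0 → ContDiffAt ℝ (⊤ : ℕ∞) h z) (p : ℝ × ℝ)
    (hp : 0 < p.1) : ContDiffAt ℝ (⊤ : ℕ∞) (fB h) p := by
  have h1 : ContDiff ℝ (⊤ : ℕ∞) (fun x : ℝ => (x : ℂ)) := Complex.ofRealCLM.contDiff
  have h2 : ContDiff ℝ (⊤ : ℕ∞) Complex.exp := Complex.contDiff_exp
  have h3 : ContDiffAt ℝ (⊤ : ℕ∞) (fun p : ℝ × ℝ => h (pE p.1 p.2)) p :=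
    ContDiffAt.comp (f := fun p : ℝ × ℝ => pE p.1 p.2) p (hs _ (pE_ne p.1 p.2 hp)) pE_smooth.contDiffAt
  unfold fB
  refine ContDiffAt.mul (ContDiff.contDiffAt ?_) h3
  fun_prop

lemma div_eq (h : ℂ → ℂ) (hs : ∀ z, z ≠ 0 → ContDiffAt ℝ (⊤ : ℕ∞) h z) (p : ℝ × ℝ)
    (hp : 0 < p.1) : fderiv ℝ (fA h) p (1, 0) + fderiv ℝ (fB h) p (0, 1) =
      2 * (p.1 * wirtingerDZ h (pE p.1 p.2)) := by
  obtain ⟨r, θ⟩ := p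
  simp only at hp ⊢
  have hh := ((hs _ (pE_ne r θ hp)).differentiableAt (by simp)).hasFDerivAt
  have a1 : HasDerivAt (fun t : ℝ => fA h (t, θ)) (fderiv ℝ (fA h) (r, θ) (1, 0)) r :=
    HasFDerivAt.comp_hasDerivAt (l := fA h) (f := fun t : ℝ => (t, θ)) r
      (((fA_smooth h hs (r, θ) hp).differentiableAt (by simp)).hasFDerivAt)
      ((hasDerivAt_id r).prodMk (hasDerivAt_const r θ))
  have a2 : HasDerivAt (fun t : ℝ => fA h (t, θ)) _ r :=
    ((Complex.ofRealCLM.hasDerivAt (x := r)).mul_const (Complex.exp (-(θ * Complex.I)))).mul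
      (hh.comp_hasDerivAt r (pE_deriv_r r θ))
  have b1 : HasDerivAt (fun t : ℝ => fB h (r, t)) (fderiv ℝ (fB h) (r, θ) (0, 1)) θ :=
    HasFDerivAt.comp_hasDerivAt (l := fB h) (f := fun t : ℝ => (r, t)) θ
      (((fB_smooth h hs (r, θ) hp).differentiableAt (by simp)).hasFDerivAt)
      ((hasDerivAt_const θ r).prodMk (hasDerivAt_id θ))
  have b2 : HasDerivAt (fun t : ℝ => fB h (r, t)) _ θ :=
    ((((Complex.ofRealCLM.hasDerivAt (x := θ)).mul_const Complex.I).neg.cexp).const_mul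
      (-Complex.I)).mul (hh.comp_hasDerivAt θ (pE_deriv r θ))
  rw [a1.unique a2, b1.unique b2, wirt_decomp, wirt_decomp]
  simp only [Complex.ofRealCLM_apply, Complex.ofReal_one, map_mul, Complex.conj_I]
  have he : Complex.exp (-(θ * Complex.I)) * Complex.exp (θ * Complex.I) = 1 := by
    rw [← Complex.exp_add]; simp
  have hc : starRingEnd ℂ (pE r θ) = r * Complex.exp (-(θ * Complex.I)) := by
    simp [pE, ← Complex.exp_conj]
  have hc2 : starRingEnd ℂ (Complex.exp (θ * Complex.I)) = Complex.exp (-(θ * Complex.I)) := by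
    simp [← Complex.exp_conj]
  rw [hc, hc2]
  generalize wirtingerDZ h (pE r θ) = w
  generalize wirtBar h (pE r θ) = v
  generalize h (pE r θ) = u
  simp only [pE]
  generalize Complex.exp (θ * Complex.I) = e at *
  generalize Complex.exp (-(θ * Complex.I)) = e' at *
  have hI := Complex.I_sq
  generalize Complex.I = i at *
  linear_combination (2 * r * w) * he + (u * e' - r * w * e * e' + r * v * e' * e') * hI

lemma cont_fd (F : ℝ × ℝ → ℂ) (p : ℝ × ℝ) (hF : ContDiffAt ℝ (⊤ : ℕ∞) F p) (v : ℝ × ℝ) :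
    ContinuousAt (fun q => fderiv ℝ F q v) p := by
  have h1 : ContDiffAt ℝ 0 (fderiv ℝ F) p := hF.fderiv_right (by simp)
  exact h1.continuousAt.clm_apply continuousAt_const

lemma rect (h : ℂ → ℂ) (hs : ∀ z, z ≠ 0 → ContDiffAt ℝ (⊤ : ℕ∞) h z) (ε R : ℝ) (hε : 0 < ε)
    (hR : ε < R) (hv : ∀ z, ‖z‖ = R → h z = 0) :
    ∫ p in Set.Icc ε R ×ˢ Set.Icc (-Real.pi) Real.pi, 2 * (p.1 * wirtingerDZ h (pE p.1 p.2)) =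
      - ∫ θ in (-Real.pi)..Real.pi, fA h (ε, θ) := by
  have hpos : ∀ p ∈ Set.Icc ((ε, -Real.pi) : ℝ × ℝ) (R, Real.pi), 0 < p.1 := fun p hp =>
    hε.trans_le hp.1.1
  have hpi := Real.pi_pos
  have key := integral_divergence_prod_Icc_of_hasFDerivAt_of_le (fA h) (fB h)
    (fderiv ℝ (fA h)) (fderiv ℝ (fB h)) (ε, -Real.pi) (R, Real.pi)
    ⟨hR.le, by simp; linarith⟩
    (fun p hp => (fA_smooth h hs p (hpos p hp)).continuousAt.continuousWithinAt)
    (fun p hp => (fB_smooth h hs p (hpos p hp)).continuousAt.continuousWithinAt)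
    (fun p hp => ((fA_smooth h hs p (hε.trans hp.1.1)).differentiableAt (by simp)).hasFDerivAt)
    (fun p hp => ((fB_smooth h hs p (hε.trans hp.1.1)).differentiableAt (by simp)).hasFDerivAt)
    (ContinuousOn.integrableOn_compact isCompact_Icc (fun p hp =>
      ((cont_fd _ p (fA_smooth h hs p (hpos p hp)) _).add
        (cont_fd _ p (fB_smooth h hs p (hpos p hp)) _)).continuousWithinAt))
  rw [setIntegral_congr_fun measurableSet_Icc (fun p hp => div_eq h hs p (hpos p hp))] at key
  rw [Set.Icc_prod_Icc, key]
  have hb : ∀ x, fB h (x, Real.pi) = fB h (x, -Real.pi) := by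
    intro x
    have := exp_pi 1
    simp only [Nat.cast_one, one_mul] at this
    simp only [fB, pE_pi, this]
  have ha : ∀ y, fA h (R, y) = 0 := by
    intro y
    simp [fA, hv _ (pE_norm R y (hε.trans hR))]
  simp [hb, ha]

lemma polar (w : ℂ → ℂ) (ε R : ℝ) (hε : 0 < ε) (hR : ε < R) (hw : ∀ z, R < ‖z‖ → w z = 0) :
    ∫ z in {z : ℂ | ε ≤ ‖z‖}, w z =
      ∫ p in Set.Icc ε R ×ˢ Set.Icc (-Real.pi) Real.pi, (p.1 : ℂ) * w (pE p.1 p.2) := by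
  have hm : MeasurableSet {z : ℂ | ε ≤ ‖z‖} := measurableSet_le measurable_const measurable_norm
  rw [← integral_indicator hm, ← Complex.integral_comp_polarCoord_symm]
  have hE : ∀ p : ℝ × ℝ, Complex.polarCoord.symm p = pE p.1 p.2 := by
    intro p
    rw [Complex.polarCoord_symm_apply, pE, Complex.exp_mul_I]; simp
  have hae : (Set.Icc ε R ×ˢ Set.Icc (-Real.pi) Real.pi : Set (ℝ × ℝ)) =ᵐ[volume]
      (Set.Icc ε R ×ˢ Set.Ioo (-Real.pi) Real.pi : Set (ℝ × ℝ)) :=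
    Measure.set_prod_ae_eq (ae_eq_refl _) Ioo_ae_eq_Icc.symm
  rw [setIntegral_congr_set hae]
  symm
  have hsub : (Set.Icc ε R ×ˢ Set.Ioo (-Real.pi) Real.pi : Set (ℝ × ℝ)) ⊆ polarCoord.target := by
    rintro p ⟨h1, h2⟩
    exact ⟨hε.trans_le h1.1, h2⟩
  rw [setIntegral_eq_of_subset_of_forall_sdiff_eq_zero (f := fun p : ℝ × ℝ =>
    p.1 • {z : ℂ | ε ≤ ‖z‖}.indicator w (Complex.polarCoord.symm p))
    polarCoord.open_target.measurableSet hsub]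
  · apply setIntegral_congr_fun (measurableSet_Icc.prod measurableSet_Ioo)
    rintro p ⟨h1, h2⟩
    have hp : 0 < p.1 := hε.trans_le h1.1
    simp only [hE]
    rw [Set.indicator_of_mem]
    · simp
    · simpa [pE_norm _ _ hp] using h1.1
  · rintro p ⟨h1, h2⟩
    have hp : 0 < p.1 := h1.1
    simp only [hE]
    by_cases hc : ε ≤ p.1
    · have : R < p.1 := by
        by_contra hcon
        exact h2 ⟨⟨hc, not_lt.1 hcon⟩, h1.2⟩
      simp [Set.indicator, hw (pE p.1 p.2) (by rwa [pE_norm _ _ hp])]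
    · simp [Set.indicator, pE_norm _ _ hp, hc]

/-- For `g : ℂ → ℂ` smooth with compact support, `m ≥ 1`, and `h` given on
`ℂ \ {0}` by `h z = g z / z ^ m`, the radial principal value of the Wirtinger derivative
`∂h/∂z` vanishes. -/
theorem stmt_2 (g : ℂ → ℂ) (hg : ContDiff ℝ (⊤ : ℕ∞) g) (hgc : HasCompactSupport g)
    (m : ℕ) (hm : 1 ≤ m) (h : ℂ → ℂ)
    (hh : ∀ z : ℂ, z ≠ 0 → h z = g z / z ^ m) :
    Tendsto (fun ε : ℝ => ∫ z in {z : ℂ | ε ≤ ‖z‖}, wirtingerDZ h z)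
      (𝓝[>] (0 : ℝ)) (𝓝 0) := by
  have hev : ∀ z : ℂ, z ≠ 0 → h =ᶠ[𝓝 z] fun z => g z / z ^ m := by
    intro z hz
    filter_upwards [isOpen_ne.mem_nhds hz] with y hy using hh y hy
  have hs : ∀ z, z ≠ 0 → ContDiffAt ℝ (⊤ : ℕ∞) h z := by
    intro z hz
    refine ContDiffAt.congr_of_eventuallyEq ?_ (hev z hz)
    simp only [div_eq_mul_inv]
    have h2 : ContDiffAt ℝ (⊤ : ℕ∞) (fun z : ℂ => z ^ m) z := by fun_prop
    exact hg.contDiffAt.mul (h2.inv (pow_ne_zero _ hz))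
  obtain ⟨R0, hR0⟩ := hgc.isCompact.isBounded.subset_closedBall (0:ℂ)
  set R := max R0 1 + 1 with hRdef
  have hR1 : 1 < R := by have := le_max_right R0 1; linarith
  have hRR : R0 < R := by have := le_max_left R0 1; linarith
  have hout : ∀ z : ℂ, R ≤ ‖z‖ → h =ᶠ[𝓝 z] fun _ => 0 := by
    intro z hz
    have hz0 : z ≠ 0 := by
      rintro rfl
      simp at hz; linarith
    have : z ∉ tsupport g := by
      intro hmem
      have := hR0 hmem
      simp at this; linarith
    filter_upwards [hev z hz0, notMem_tsupport_iff_eventuallyEq.1 this] with y h1 h2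
    rw [h1, h2]; simp
  have hw : ∀ z : ℂ, R < ‖z‖ → wirtingerDZ h z = 0 := by
    intro z hz
    simp [wirtingerDZ, (hout z hz.le).fderiv_eq]
  obtain ⟨C, hC⟩ := fc_bound (m + 1) 0 g hg
  have hform : ∀ ε : ℝ, 0 < ε → ε < 1 →
      ‖∫ z in {z : ℂ | ε ≤ ‖z‖}, wirtingerDZ h z‖ ≤ (1 / 2) * C * ε ^ 2 := by
    intro ε h0 h1
    have hr := rect h hs ε R h0 (h1.trans hR1) (fun z hz => (hout z hz.ge).eq_of_nhds)
    rw [integral_const_mul, ← polar _ ε R h0 (h1.trans hR1) hw] at hr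
    have hfa : ∀ θ : ℝ, fA h (ε, θ) = (ε / ε ^ m : ℂ) *
        (g (pE ε θ) * Complex.exp (-(((m + 1 + 0 : ℕ) : ℂ) * (θ * Complex.I)))) := by
      intro θ
      have e1 : Complex.exp (-(((m + 1 + 0 : ℕ) : ℂ) * (θ * Complex.I))) =
          Complex.exp (-(θ * Complex.I)) * (Complex.exp (θ * Complex.I) ^ m)⁻¹ := by
        rw [← Complex.exp_nat_mul, ← Complex.exp_neg, ← Complex.exp_add]
        congr 1; push_cast; ring
      simp only [fA]
      rw [hh _ (pE_ne ε θ h0), e1]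
      simp only [pE, mul_pow, div_eq_mul_inv, mul_inv]
      ring
    simp only [hfa] at hr
    rw [intervalIntegral.integral_const_mul] at hr
    change _ = -(_ * fc g (m + 1 + 0) ε) at hr
    have hn := congrArg norm hr
    rw [norm_neg, norm_mul, norm_mul, norm_div, norm_pow, Complex.norm_real, Real.norm_of_nonneg h0.le,
      Complex.norm_ofNat] at hn
    have hb := hC ε h0 h1.le
    have : ε / ε ^ m * ‖fc g (m + 1 + 0) ε‖ ≤ ε / ε ^ m * (C * ε ^ (m + 1)) := by gcongr
    have e2 : ε / ε ^ m * (C * ε ^ (m + 1)) = C * ε ^ 2 := by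
      field_simp
      ring
    linarith
  apply squeeze_zero_norm' (a := fun ε : ℝ => (1 / 2) * C * ε ^ 2)
  · filter_upwards [Ioo_mem_nhdsGT (show (0:ℝ) < 1 by norm_num)] with ε hε
    exact hform ε hε.1 hε.2
  · have : Tendsto (fun ε : ℝ => (1 / 2) * C * ε ^ 2) (𝓝 0) (𝓝 ((1 / 2) * C * 0 ^ 2)) :=
      Continuous.tendsto (by fun_prop) 0
    simp at this
    simpa using this.mono_left nhdsWithin_le_nhds
end

section
/- Let a₁, a₂, g₁, g₂ : ℂ → ℂ be smooth (infinitely differentiable over ℝ) with compact support, and let m₁, m₂ ≥ 1 be natural numbers. Suppose that for all z ≠ 0, a₁(z)/z + (∂/∂z)(g₁(z)·z^{−m₁}) = a₂(z)/z + (∂/∂z)(g₂(z)·z^{−m₂}). Then ∫_ℂ a₁(z)/z dA(z) = ∫_ℂ a₂(z)/z dA(z) (both integrands being integrable on ℂ). -/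
open MeasureTheory Filter Topology

theorem aux_integrable (a : ℂ → ℂ) (ha : Continuous a) (hc : HasCompactSupport a) :
    Integrable (fun z : ℂ => a z / z) := by
  have hl : LocallyIntegrable (fun z : ℂ => z⁻¹) := by
    refine locallyIntegrable_of_norm_le_rpow (C := 1) (α := 1) (by simp) (by simp) ?_ ?_
    · exact Eventually.of_forall fun z => by simp [Real.rpow_neg_one]
    · exact (measurable_inv (G := ℂ)).aestronglyMeasurable
  have := hl.integrable_smul_left_of_hasCompactSupport ha hc
  simpa [div_eq_mul_inv] using this

theorem aux_rot (L : ℂ →L[ℝ] ℂ) (ω : ℂ) :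
    L ω - Complex.I * L (ω * Complex.I) = ω * (L 1 - Complex.I * L Complex.I) := by
  have h1 : L ω = ω.re * L 1 + ω.im * L Complex.I := by
    have : ω = ω.re • (1 : ℂ) + ω.im • Complex.I := by simp
    conv_lhs => rw [this, map_add, map_smul, map_smul]
    simp
  have h2 : L (ω * Complex.I) = ω.re * L Complex.I - ω.im * L 1 := by
    have : ω * Complex.I = ω.re • Complex.I - ω.im • (1 : ℂ) := by
      apply Complex.ext <;> simp
    conv_lhs => rw [this, map_sub, map_smul, map_smul]
    simp
  rw [h1, h2]
  conv_rhs => rw [← Complex.re_add_im ω]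
  linear_combination ((ω.im : ℂ) * L Complex.I) * Complex.I_sq

theorem aux_rot' (L : ℂ →L[ℝ] ℂ) (ω : ℂ) :
    L ω + Complex.I * L (ω * Complex.I) =
      (starRingEnd ℂ) ω * (L 1 + Complex.I * L Complex.I) := by
  have h1 : L ω = ω.re * L 1 + ω.im * L Complex.I := by
    have : ω = ω.re • (1 : ℂ) + ω.im • Complex.I := by simp
    conv_lhs => rw [this, map_add, map_smul, map_smul]
    simp
  have h2 : L (ω * Complex.I) = ω.re * L Complex.I - ω.im * L 1 := by
    have : ω * Complex.I = ω.re • Complex.I - ω.im • (1 : ℂ) := by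
      apply Complex.ext <;> simp
    conv_lhs => rw [this, map_sub, map_smul, map_smul]
    simp
  have h3 : (starRingEnd ℂ) ω = ω.re - ω.im * Complex.I := by
    apply Complex.ext <;> simp
  rw [h1, h2, h3]
  linear_combination ((ω.im : ℂ) * L Complex.I) * Complex.I_sq

theorem aux_vanish (ω : ℂ) (hω : ‖ω‖ = 1) (n : ℕ) : ∀ (k : ℤ) (g : ℂ → ℂ),
    ContDiff ℝ (⊤ : ℕ∞) g → (∀ z, g (ω * z) = ω ^ k * g z) →
    (∀ j : ℤ, k - n < j → j < k + n → ω ^ j ≠ 1) →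
    ∃ C : ℝ, 0 ≤ C ∧ ∀ z : ℂ, ‖z‖ ≤ 1 → ‖g z‖ ≤ C * ‖z‖ ^ n := by
  have hω0 : ω ≠ 0 := by rintro rfl; simp at hω
  induction n with
  | zero =>
    intro k g hg _ _
    obtain ⟨C, hC⟩ := (isCompact_closedBall (0 : ℂ) 1).exists_bound_of_continuousOn
      hg.continuous.continuousOn
    refine ⟨C, (norm_nonneg _).trans (hC 0 (by simp)), fun z hz => ?_⟩
    simpa using hC z (by simpa using hz)
  | succ n ih =>
    intro k g hg hk hj
    have hd : Differentiable ℝ g := hg.differentiable (by simp)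
    have hfd : ContDiff ℝ (⊤ : ℕ∞) (fderiv ℝ g) := hg.fderiv_right (by simp)
    have hv : ∀ v : ℂ, ContDiff ℝ (⊤ : ℕ∞) (fun z => fderiv ℝ g z v) := fun v =>
      hfd.clm_apply contDiff_const
    have hD : ∀ z v, fderiv ℝ g (ω * z) (ω * v) = ω ^ k * fderiv ℝ g z v := by
      intro z v
      have h1 : HasFDerivAt (fun z => g (ω * z))
          ((fderiv ℝ g (ω * z)).comp (ContinuousLinearMap.mul ℝ ℂ ω)) z :=
        (hd (ω * z)).hasFDerivAt.comp z (ContinuousLinearMap.mul ℝ ℂ ω).hasFDerivAt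
      have h2 : HasFDerivAt (fun z => ω ^ k * g z) (ω ^ k • fderiv ℝ g z) z :=
        (hd z).hasFDerivAt.const_mul (ω ^ k)
      rw [← funext hk] at h2
      have := congrArg (fun L : ℂ →L[ℝ] ℂ => L v) (h1.unique h2)
      simpa using this
    obtain ⟨C₁, hC₁, h₁⟩ := ih (k - 1)
      (fun z => fderiv ℝ g z 1 - Complex.I * fderiv ℝ g z Complex.I)
      ((hv 1).sub (contDiff_const.mul (hv _))) (by
        intro z
        have := aux_rot (fderiv ℝ g (ω * z)) ω
        have e1 := hD z 1
        rw [mul_one] at e1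
        rw [e1, hD] at this
        rw [zpow_sub_one₀ hω0]
        field_simp
        linear_combination -this) (by
        intro j h1 h2
        exact hj j (by push_cast; lia) (by push_cast; lia))
    obtain ⟨C₂, hC₂, h₂⟩ := ih (k + 1)
      (fun z => fderiv ℝ g z 1 + Complex.I * fderiv ℝ g z Complex.I)
      ((hv 1).add (contDiff_const.mul (hv _))) (by
        intro z
        have := aux_rot' (fderiv ℝ g (ω * z)) ω
        have e1 := hD z 1
        rw [mul_one] at e1
        rw [e1, hD] at this
        have hc : ω * (starRingEnd ℂ) ω = 1 := by
          rw [Complex.mul_conj, Complex.normSq_eq_norm_sq, hω]; simp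
        rw [zpow_add_one₀ hω0]
        linear_combination (-ω) * this - (fderiv ℝ g (ω * z) 1 + Complex.I * fderiv ℝ g (ω * z) Complex.I) * hc) (by
        intro j h1 h2
        exact hj j (by push_cast; lia) (by push_cast; lia))
    have hg0 : g 0 = 0 := by
      have h1 := hk 0
      have h2 := hj k (by push_cast; lia) (by push_cast; lia)
      rw [mul_zero] at h1
      have : (ω ^ k - 1) * g 0 = 0 := by linear_combination -h1
      exact (mul_eq_zero.1 this).resolve_left (sub_ne_zero.2 h2)
    refine ⟨C₁ + C₂, by positivity, fun z hz => ?_⟩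
    have hb : ∀ x ∈ Metric.closedBall (0 : ℂ) ‖z‖, ‖fderiv ℝ g x‖ ≤ (C₁ + C₂) * ‖z‖ ^ n := by
      intro x hx
      have hx' : ‖x‖ ≤ ‖z‖ := by simpa using hx
      refine ContinuousLinearMap.opNorm_le_bound _ (by positivity) fun v => ?_
      set L := fderiv ℝ g x with hL
      have e : L v = (1 / 2) * (v * (L 1 - Complex.I * L Complex.I)
          + (starRingEnd ℂ) v * (L 1 + Complex.I * L Complex.I)) := by
        rw [← aux_rot, ← aux_rot']; ring
      have b1 : ‖L 1 - Complex.I * L Complex.I‖ ≤ C₁ * ‖z‖ ^ n :=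
        (h₁ x (hx'.trans hz)).trans (by gcongr)
      have b2 : ‖L 1 + Complex.I * L Complex.I‖ ≤ C₂ * ‖z‖ ^ n :=
        (h₂ x (hx'.trans hz)).trans (by gcongr)
      rw [e, norm_mul]
      have b3 := norm_add_le (v * (L 1 - Complex.I * L Complex.I))
        ((starRingEnd ℂ) v * (L 1 + Complex.I * L Complex.I))
      rw [norm_mul, norm_mul, RCLike.norm_conj] at b3
      have b4 := mul_le_mul_of_nonneg_left b1 (norm_nonneg v)
      have b5 := mul_le_mul_of_nonneg_left b2 (norm_nonneg v)
      have : ‖(1 / 2 : ℂ)‖ = 1 / 2 := by norm_num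
      rw [this]
      have : 0 ≤ (C₁ + C₂) * ‖z‖ ^ n * ‖v‖ := by positivity
      nlinarith
    have := (convex_closedBall (0 : ℂ) ‖z‖).norm_image_sub_le_of_norm_fderiv_le (𝕜 := ℝ)
      (fun x _ => hd x) hb (x := 0) (y := z) (by simp) (by simp)
    rw [hg0, sub_zero, sub_zero] at this
    rw [pow_succ]; linarith

/-- Stokes for a continuous compactly supported function, differentiable off the origin. -/
theorem aux_stokes (G F : ℂ → ℂ) (hG : Continuous G) (hc : HasCompactSupport G)
    (hd : ∀ z, z ≠ 0 → DifferentiableAt ℝ G z)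
    (hF : ∀ z, z ≠ 0 → F z = wirtingerDZ G z) (hi : Integrable F) : ∫ z, F z = 0 := by
  obtain ⟨R, hR0, hR⟩ : ∃ R : ℝ, 0 < R ∧ ∀ z : ℂ, R ≤ ‖z‖ → z ∉ tsupport G := by
    obtain ⟨R, hR0, hR⟩ := hc.isCompact.isBounded.exists_pos_norm_lt
    exact ⟨R, hR0, fun z hz hz' => absurd (hR z hz') (not_lt.2 hz)⟩
  have hG0 : ∀ z : ℂ, R ≤ ‖z‖ → G z = 0 := fun z hz => image_eq_zero_of_notMem_tsupport (hR z hz)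
  have hF0 : ∀ z : ℂ, R ≤ ‖z‖ → F z = 0 := by
    intro z hz
    have hz0 : z ≠ 0 := by rintro rfl; simp at hz; linarith
    have : fderiv ℝ G z = 0 := by
      by_contra h
      exact hR z hz (support_fderiv_subset ℝ h)
    rw [hF z hz0, wirtingerDZ, this]; simp
  -- the function obtained by conjugation
  have hae : ∀ᵐ z : ℂ, z ≠ 0 := by
    simp [ae_iff, measure_singleton]
  have key : ∀ z : ℂ, z ≠ 0 → Complex.I • (((Complex.conjCLE : ℂ →L[ℝ] ℂ).comp (fderiv ℝ G z)) 1)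
      - ((Complex.conjCLE : ℂ →L[ℝ] ℂ).comp (fderiv ℝ G z)) Complex.I
      = (2 * Complex.I) * (starRingEnd ℂ) (F z) := by
    intro z hz
    rw [hF z hz, wirtingerDZ]
    have h2 : (starRingEnd ℂ) 2 = 2 := Complex.conj_ofNat 2
    simp [h2]
    linear_combination -((starRingEnd ℂ) (fderiv ℝ G z Complex.I)) * Complex.I_sq
  have hconj : Integrable (fun z => (2 * Complex.I) * (starRingEnd ℂ) (F z)) :=
    ((Complex.conjCLE : ℂ →L[ℝ] ℂ).integrable_comp hi).const_mul _
  have st := Complex.integral_boundary_rect_of_hasFDerivAt_real_off_countable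
    (fun z => (starRingEnd ℂ) (G z))
    (fun z => (Complex.conjCLE : ℂ →L[ℝ] ℂ).comp (fderiv ℝ G z))
    (⟨-R, -R⟩) (⟨R, R⟩) {0} (Set.countable_singleton 0)
    (Complex.continuous_conj.comp hG).continuousOn
    (fun x hx => (Complex.conjCLE : ℂ →L[ℝ] ℂ).hasFDerivAt.comp x (hd x hx.2).hasFDerivAt)
    (Integrable.integrableOn (hconj.congr (hae.mono fun z hz => (key z hz).symm)))
  have hb1 : ∀ x y : ℝ, R ≤ |y| → G (x + y * Complex.I) = 0 := fun x y h => hG0 _ <| by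
    have := Complex.abs_im_le_norm (x + y * Complex.I)
    simp at this; linarith
  have hb2 : ∀ x y : ℝ, R ≤ |x| → G (x + y * Complex.I) = 0 := fun x y h => hG0 _ <| by
    have := Complex.abs_re_le_norm (x + y * Complex.I)
    simp at this; linarith
  have hRR : R ≤ |R| := le_abs_self R
  have hRR' : R ≤ |-R| := by rw [abs_neg]; exact hRR
  simp only [hb1 _ _ hRR, hb1 _ _ hRR', hb2 _ _ hRR, hb2 _ _ hRR', map_zero,
    intervalIntegral.integral_zero, smul_zero, sub_zero, add_zero] at st
  set H : ℂ → ℂ := fun z => Complex.I • (((Complex.conjCLE : ℂ →L[ℝ] ℂ).comp (fderiv ℝ G z)) 1)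
      - ((Complex.conjCLE : ℂ →L[ℝ] ℂ).comp (fderiv ℝ G z)) Complex.I with hH
  have hHi : Integrable H := hconj.congr (hae.mono fun z hz => (key z hz).symm)
  have hH0 : ∀ z : ℂ, R ≤ ‖z‖ → H z = 0 := by
    intro z hz
    have hz0 : z ≠ 0 := by rintro rfl; simp at hz; linarith
    rw [hH]; beta_reduce; rw [key z hz0, hF0 z hz]; simp
  have hHint : ∫ z, H z = 0 := by
    rw [← (Complex.volume_preserving_equiv_real_prod.symm).integral_comp
      Complex.measurableEquivRealProd.symm.measurableEmbedding H]
    have hHi2 : Integrable (fun p : ℝ × ℝ => H (Complex.measurableEquivRealProd.symm p)) :=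
      ((Complex.volume_preserving_equiv_real_prod.symm).integrable_comp_emb
        Complex.measurableEquivRealProd.symm.measurableEmbedding).2 hHi
    have heq : ∀ p : ℝ × ℝ, Complex.measurableEquivRealProd.symm p = p.1 + p.2 * Complex.I :=
      fun p => Complex.mk_eq_add_mul_I p.1 p.2
    simp only [heq] at hHi2 ⊢
    rw [st, ← setIntegral_eq_integral_of_forall_compl_eq_zero
      (s := Set.Ioc (-R) R ×ˢ Set.Ioc (-R) R), Measure.volume_eq_prod, setIntegral_prod]
    · simp only [intervalIntegral.integral_of_le (by linarith : -R ≤ R)]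
      rfl
    · exact hHi2.integrableOn
    · intro p hp
      apply hH0
      by_contra hcon
      push Not at hcon
      have h1 := Complex.abs_im_le_norm (p.1 + p.2 * Complex.I)
      have h2 := Complex.abs_re_le_norm (p.1 + p.2 * Complex.I)
      simp at h1 h2
      have h3 := abs_lt.1 (h1.trans_lt hcon)
      have h4 := abs_lt.1 (h2.trans_lt hcon)
      exact hp ⟨⟨h4.1, h4.2.le⟩, ⟨h3.1, h3.2.le⟩⟩
  have h5 : ∫ z, H z = (2 * Complex.I) * (starRingEnd ℂ) (∫ z, F z) := by
    rw [integral_congr_ae (hae.mono fun z hz => key z hz), integral_const_mul, integral_conj]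
  rw [h5] at hHint
  simpa using hHint

theorem aux_main (a g : ℂ → ℂ) (ha : Continuous a) (hac : HasCompactSupport a)
    (hg : ContDiff ℝ (⊤ : ℕ∞) g) (hgc : HasCompactSupport g) (m : ℕ)
    (h : ∀ z : ℂ, z ≠ 0 → a z / z = wirtingerDZ (fun w : ℂ => g w * w ^ (-(m : ℤ))) z) :
    ∫ z : ℂ, a z / z = 0 := by
  set N : ℕ := 2 * m + 3 with hN
  have hN0 : N ≠ 0 := by lia
  obtain ⟨ω, hω⟩ : ∃ ω : ℂ, IsPrimitiveRoot ω N := ⟨_, Complex.isPrimitiveRoot_exp N hN0⟩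
  have hω1 : ‖ω‖ = 1 := hω.norm'_eq_one hN0
  have hω0 : ω ≠ 0 := by rintro rfl; simp at hω1
  have hpow0 : ∀ l : ℕ, ω ^ l ≠ 0 := fun l => pow_ne_zero l hω0
  -- averaged numerator
  set u : ℕ → ℂ → ℂ := fun l z => ((ω ^ l) ^ (m + 1))⁻¹ * g (ω ^ l * z) with hu
  set ĝ : ℂ → ℂ := fun z => ∑ l ∈ Finset.range N, u l z with hĝ
  have hĝs : ContDiff ℝ (⊤ : ℕ∞) ĝ := by
    refine ContDiff.sum fun l _ => contDiff_const.mul (hg.comp (contDiff_const.mul contDiff_id))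
  have hĝw : ∀ z, ĝ (ω * z) = ω ^ ((m + 1 : ℕ) : ℤ) * ĝ z := by
    intro z
    have e1 : ∀ l, u l (ω * z) = ω ^ (m + 1) * u (l + 1) z := by
      intro l
      simp only [hu, pow_succ ω l, mul_pow, mul_assoc]
      have := hpow0 l
      field_simp
    have e2 : ∑ l ∈ Finset.range N, u (l + 1) z = ∑ l ∈ Finset.range N, u l z := by
      have h1 := Finset.sum_range_succ (fun l => u l z) N
      have h2 := Finset.sum_range_succ' (fun l => u l z) N
      have h3 : u N z = u 0 z := by simp [hu, hω.pow_eq_one]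
      rw [h1, h3] at h2
      exact (add_right_cancel h2).symm
    simp only [hĝ, e1, zpow_natCast]
    rw [← Finset.mul_sum, e2]
  obtain ⟨C, hC0, hC⟩ := aux_vanish ω hω1 (m + 1) ((m + 1 : ℕ) : ℤ) ĝ hĝs hĝw (by
    intro j h1 h2 h3
    rw [hω.zpow_eq_one_iff_dvd] at h3
    have := Int.le_of_dvd (by lia) h3
    lia)
  set G : ℂ → ℂ := fun w : ℂ => g w * w ^ (-(m : ℤ)) with hG
  have hGd : ∀ z, z ≠ 0 → DifferentiableAt ℝ G z := by
    intro z hz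
    refine (hg.differentiable (by simp) z).mul ?_
    exact ((differentiableAt_zpow (𝕜 := ℂ) (m := -(m : ℤ))).2 (Or.inl hz)).restrictScalars ℝ
  set Ĝ : ℂ → ℂ := fun z => ĝ z * z ^ (-(m : ℤ)) with hĜ
  have hĜsum : Ĝ = fun z => ∑ l ∈ Finset.range N, (ω ^ l)⁻¹ * G (ω ^ l * z) := by
    funext z
    simp only [hĜ, hĝ, hG, Finset.sum_mul, hu]
    refine Finset.sum_congr rfl fun l _ => ?_
    rw [mul_zpow, zpow_neg, zpow_neg, zpow_natCast, zpow_natCast, pow_succ]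
    have := hpow0 l
    field_simp
  have hD : ∀ z, z ≠ 0 → HasFDerivAt Ĝ (∑ l ∈ Finset.range N,
      (ω ^ l)⁻¹ • (fderiv ℝ G (ω ^ l * z)).comp (ContinuousLinearMap.mul ℝ ℂ (ω ^ l))) z := by
    intro z hz
    rw [hĜsum]
    refine HasFDerivAt.fun_sum fun l _ => HasFDerivAt.const_mul ?_ _
    exact (hGd _ (mul_ne_zero (hpow0 l) hz)).hasFDerivAt.comp z
      (ContinuousLinearMap.mul ℝ ℂ (ω ^ l)).hasFDerivAt
  have hĜc : Continuous Ĝ := by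
    rw [continuous_iff_continuousAt]
    intro z
    by_cases hz : z = 0
    · subst hz
      have hb : ∀ z : ℂ, ‖z‖ ≤ 1 → ‖Ĝ z‖ ≤ C * ‖z‖ := by
        intro z hz
        simp only [hĜ, norm_mul, norm_zpow]
        by_cases h0 : z = 0
        · have := hC 0 (by simp)
          subst h0
          simp at this
          simp [this]
        have hp : 0 < ‖z‖ := norm_pos_iff.2 h0
        calc ‖ĝ z‖ * ‖z‖ ^ (-(m : ℤ)) ≤ C * ‖z‖ ^ (m + 1) * ‖z‖ ^ (-(m : ℤ)) := by
              gcongr; exact hC z hz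
          _ = C * ‖z‖ := by
              rw [zpow_neg, zpow_natCast, pow_succ]; field_simp
      have h0 : Ĝ 0 = 0 := by simpa using hb 0 (by simp)
      rw [ContinuousAt, h0]
      refine squeeze_zero_norm' (a := fun z : ℂ => C * ‖z‖) ?_ ?_
      · filter_upwards [Metric.closedBall_mem_nhds (0 : ℂ) one_pos] with z hz
        exact hb z (by simpa using hz)
      · have : Continuous fun z : ℂ => C * ‖z‖ := by fun_prop
        simpa using this.tendsto 0
    · exact (hD z hz).continuousAt
  have hĜcs : HasCompactSupport Ĝ := by
    obtain ⟨R, hR0, hR⟩ := hgc.isCompact.isBounded.exists_pos_norm_le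
    refine HasCompactSupport.of_support_subset_isCompact (isCompact_closedBall (0 : ℂ) R) ?_
    intro z hz
    by_contra hcon
    apply hz
    have : ∀ l, g (ω ^ l * z) = 0 := by
      intro l
      apply image_eq_zero_of_notMem_tsupport
      intro hmem
      have := hR _ hmem
      simp [hω1] at this hcon
      linarith
    simp [hĜ, hĝ, hu, this]
  have hi : Integrable (fun z => a z / z) := aux_integrable a ha hac
  have hrot : ∀ c : ℂ, ‖c‖ = 1 → MeasurePreserving (fun z : ℂ => c * z) volume volume ∧
      MeasurableEmbedding (fun z : ℂ => c * z) := by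
    intro c hc
    let e := rotation (⟨c, by simpa [Submonoid.unitSphere] using hc⟩ : Circle)
    exact ⟨e.measurePreserving, e.toHomeomorph.measurableEmbedding⟩
  have hn : ∀ l : ℕ, ‖ω ^ l‖ = 1 := fun l => by simp [hω1]
  have hil : ∀ l : ℕ, Integrable (fun z => a (ω ^ l * z) / (ω ^ l * z)) := fun l =>
    ((hrot _ (hn l)).1.integrable_comp_emb (hrot _ (hn l)).2).2 hi
  have hIl : ∀ l : ℕ, ∫ z, a (ω ^ l * z) / (ω ^ l * z) = ∫ z, a z / z := fun l =>
    (hrot _ (hn l)).1.integral_comp (hrot _ (hn l)).2 (fun z => a z / z)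
  have fin := aux_stokes Ĝ (fun z => ∑ l ∈ Finset.range N, a (ω ^ l * z) / (ω ^ l * z))
    hĜc hĜcs (fun z hz => (hD z hz).differentiableAt) (by
      intro z hz
      rw [wirtingerDZ, (hD z hz).fderiv]
      simp only [ContinuousLinearMap.sum_apply, ContinuousLinearMap.smul_apply,
        ContinuousLinearMap.comp_apply, ContinuousLinearMap.mul_apply', mul_one, smul_eq_mul,
        Finset.mul_sum, ← Finset.sum_sub_distrib]
      refine Finset.sum_congr rfl fun l _ => ?_
      rw [h _ (mul_ne_zero (hpow0 l) hz), wirtingerDZ]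
      have := aux_rot (fderiv ℝ G (ω ^ l * z)) (ω ^ l)
      have h0 := hpow0 l
      field_simp
      linear_combination -this) (integrable_finset_sum _ fun l _ => hil l)
  rw [integral_finset_sum _ fun l _ => hil l] at fin
  simp only [hIl, Finset.sum_const, Finset.card_range, nsmul_eq_mul] at fin
  exact (mul_eq_zero.1 fin).resolve_left (by exact_mod_cast hN0)

/-- independence of the regularized integral on the decomposition.
If `a₁ z / z + ∂_z(g₁ z · z^{-m₁}) = a₂ z / z + ∂_z(g₂ z · z^{-m₂})` away from `0`, with
`a₁, a₂, g₁, g₂` smooth compactly supported and `m₁, m₂ ≥ 1`, then the (integrable)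
integrands `a₁ z / z` and `a₂ z / z` have equal integrals over `ℂ`. -/
theorem stmt_4 (a₁ a₂ g₁ g₂ : ℂ → ℂ)
    (ha₁ : ContDiff ℝ (⊤ : ℕ∞) a₁) (ha₁c : HasCompactSupport a₁)
    (ha₂ : ContDiff ℝ (⊤ : ℕ∞) a₂) (ha₂c : HasCompactSupport a₂)
    (hg₁ : ContDiff ℝ (⊤ : ℕ∞) g₁) (hg₁c : HasCompactSupport g₁)
    (hg₂ : ContDiff ℝ (⊤ : ℕ∞) g₂) (hg₂c : HasCompactSupport g₂)
    (m₁ m₂ : ℕ) (hm₁ : 1 ≤ m₁) (hm₂ : 1 ≤ m₂)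
    (heq : ∀ z : ℂ, z ≠ 0 →
      a₁ z / z + wirtingerDZ (fun w : ℂ => g₁ w * w ^ (-(m₁ : ℤ))) z
        = a₂ z / z + wirtingerDZ (fun w : ℂ => g₂ w * w ^ (-(m₂ : ℤ))) z) :
    Integrable (fun z : ℂ => a₁ z / z) ∧ Integrable (fun z : ℂ => a₂ z / z) ∧
    ∫ z : ℂ, a₁ z / z = ∫ z : ℂ, a₂ z / z := by
  have i₁ := aux_integrable a₁ ha₁.continuous ha₁c
  have i₂ := aux_integrable a₂ ha₂.continuous ha₂c
  refine ⟨i₁, i₂, ?_⟩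
  have hz1 : ∀ (n : ℕ), ContDiff ℝ (⊤ : ℕ∞) (fun z : ℂ => z ^ n) := fun n => contDiff_id.pow n
  have key := aux_main (fun z => a₁ z - a₂ z) (fun z => g₂ z * z ^ m₁ - g₁ z * z ^ m₂)
    (ha₁.continuous.sub ha₂.continuous) (ha₁c.sub ha₂c)
    ((hg₂.mul (hz1 _)).sub (hg₁.mul (hz1 _))) (hg₂c.mul_right.sub hg₁c.mul_right) (m₁ + m₂) (by
      intro z hz
      have hdz : ∀ n : ℕ, DifferentiableAt ℝ (fun w : ℂ => w ^ (-(n : ℤ))) z := fun n =>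
        ((differentiableAt_zpow (𝕜 := ℂ) (m := -(n : ℤ))).2 (Or.inl hz)).restrictScalars ℝ
      have d₁ : DifferentiableAt ℝ (fun w : ℂ => g₁ w * w ^ (-(m₁ : ℤ))) z :=
        (hg₁.differentiable (by simp) z).mul (hdz m₁)
      have d₂ : DifferentiableAt ℝ (fun w : ℂ => g₂ w * w ^ (-(m₂ : ℤ))) z :=
        (hg₂.differentiable (by simp) z).mul (hdz m₂)
      have e : (fun w : ℂ => (g₂ w * w ^ m₁ - g₁ w * w ^ m₂) * w ^ (-((m₁ + m₂ : ℕ) : ℤ)))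
          =ᶠ[𝓝 z] fun w => g₂ w * w ^ (-(m₂ : ℤ)) - g₁ w * w ^ (-(m₁ : ℤ)) := by
        filter_upwards [isOpen_ne.mem_nhds hz] with w hw
        have hw : w ≠ 0 := hw
        simp only [zpow_neg, zpow_natCast, pow_add]
        field_simp
      have hh := heq z hz
      rw [wirtingerDZ, e.fderiv_eq, fderiv_fun_sub d₂ d₁]
      simp only [wirtingerDZ] at hh
      simp only [ContinuousLinearMap.sub_apply, sub_div]
      linear_combination hh)
  simp only [sub_div] at key
  rw [integral_sub i₁ i₂] at key
  exact sub_eq_zero.1 key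
end

section
/- Let g : ℂ → ℂ be smooth (infinitely differentiable over ℝ), let f : ℂ → ℂ be smooth with compact support, and let m ≥ 1 be a natural number. Then both limits L₁ := lim_{ε→0⁺} ∫_{{z : ℂ | ε ≤ ‖z‖}} f(z) · (∂/∂z)(g(z)·z^{−m}) dA(z) and L₂ := lim_{ε→0⁺} ∫_{{z : ℂ | ε ≤ ‖z‖}} g(z)·z^{−m} · (∂f/∂z)(z) dA(z) exist, and L₁ + L₂ = 0. -/
open MeasureTheory Filter Topology

noncomputable def ang (φ : ℂ → ℂ) (k : ℕ) (r : ℝ) : ℂ :=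
  ∫ θ in (-Real.pi)..Real.pi,
    φ ((r : ℂ) * Complex.exp (θ * Complex.I)) * Complex.exp (-(k * θ * Complex.I))

lemma wd_smooth {f : ℂ → ℂ} (hf : ContDiff ℝ (⊤ : ℕ∞) f) : ContDiff ℝ (⊤ : ℕ∞) (wirtingerDZ f) := by
  have h : ContDiff ℝ (⊤ : ℕ∞) (fderiv ℝ f) := hf.fderiv_right (by simp)
  unfold wirtingerDZ
  fun_prop

lemma wb_smooth {f : ℂ → ℂ} (hf : ContDiff ℝ (⊤ : ℕ∞) f) : ContDiff ℝ (⊤ : ℕ∞) (wirtBar f) := by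
  have h : ContDiff ℝ (⊤ : ℕ∞) (fderiv ℝ f) := hf.fderiv_right (by simp)
  unfold wirtBar
  fun_prop

lemma fderiv_wirt (f : ℂ → ℂ) (z v : ℂ) :
    fderiv ℝ f z v = v * wirtingerDZ f z + (starRingEnd ℂ) v * wirtBar f z := by
  have h : fderiv ℝ f z v = (v.re : ℂ) * fderiv ℝ f z 1 + (v.im : ℂ) * fderiv ℝ f z Complex.I := by
    conv_lhs => rw [show v = v.re • (1 : ℂ) + v.im • Complex.I by
      simp [Complex.re_add_im]]
    rw [map_add, map_smul, map_smul]
    simp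
  rw [h, wirtingerDZ, wirtBar]
  have h1 : (starRingEnd ℂ) v = v.re - v.im * Complex.I := by
    apply Complex.ext <;> simp
  rw [h1]
  conv_rhs => rw [show v * ((1 / 2 : ℂ) * (fderiv ℝ f z 1 - Complex.I * fderiv ℝ f z Complex.I)) = (v.re + v.im * Complex.I) * ((1 / 2 : ℂ) * (fderiv ℝ f z 1 - Complex.I * fderiv ℝ f z Complex.I)) by rw [Complex.re_add_im]]
  linear_combination ((v.im : ℂ) * fderiv ℝ f z Complex.I) * Complex.I_sq

lemma conj_exp_I (θ : ℝ) : (starRingEnd ℂ) (Complex.exp (θ * Complex.I)) = Complex.exp (-(θ * Complex.I)) := by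
  rw [← Complex.exp_conj]; simp

/-- angular integration by parts -/
lemma ang_parts_s5 {φ : ℂ → ℂ} (hφ : ContDiff ℝ (⊤ : ℕ∞) φ) (k : ℕ) (r : ℝ) :
    ((k + 1 : ℕ) : ℂ) * ang φ (k + 1) r =
      r * (ang (wirtingerDZ φ) k r - ang (wirtBar φ) (k + 2) r) := by
  have cd := (wd_smooth hφ).continuous
  have cb := (wb_smooth hφ).continuous
  have c0 := hφ.continuous
  -- total derivative integrates to zero
  have key : ∀ θ : ℝ, HasDerivAt (fun θ : ℝ => φ ((r : ℂ) * Complex.exp (θ * Complex.I)) *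
      Complex.exp (-(((k + 1 : ℕ) : ℂ) * θ * Complex.I)))
      (Complex.I * (r * (wirtingerDZ φ ((r : ℂ) * Complex.exp (θ * Complex.I)) * Complex.exp (-((k : ℂ) * θ * Complex.I))
        - wirtBar φ ((r : ℂ) * Complex.exp (θ * Complex.I)) * Complex.exp (-(((k + 2 : ℕ) : ℂ) * θ * Complex.I)))
        - ((k + 1 : ℕ) : ℂ) * (φ ((r : ℂ) * Complex.exp (θ * Complex.I)) * Complex.exp (-(((k + 1 : ℕ) : ℂ) * θ * Complex.I))))) θ := by
    intro θ
    have h0 : HasDerivAt (fun θ : ℝ => (θ : ℂ)) 1 θ := Complex.ofRealCLM.hasDerivAt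
    have h1 : HasDerivAt (fun θ : ℝ => (r : ℂ) * Complex.exp (θ * Complex.I))
        (r * (Complex.exp (θ * Complex.I) * (1 * Complex.I))) θ :=
      ((h0.mul_const Complex.I).cexp).const_mul _
    have h2 : HasDerivAt (fun θ : ℝ => Complex.exp (-(((k + 1 : ℕ) : ℂ) * θ * Complex.I)))
        (Complex.exp (-(((k + 1 : ℕ) : ℂ) * θ * Complex.I)) * -(((k + 1 : ℕ) : ℂ) * 1 * Complex.I)) θ :=
      (((h0.const_mul _).mul_const Complex.I).neg).cexp
    have h3 : HasFDerivAt φ (fderiv ℝ φ ((r : ℂ) * Complex.exp (θ * Complex.I))) ((r : ℂ) * Complex.exp (θ * Complex.I)) :=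
      (hφ.differentiable (by simp)).differentiableAt.hasFDerivAt
    have h4 := (h3.comp_hasDerivAt θ h1).mul h2
    refine h4.congr_deriv ?_
    rw [fderiv_wirt]
    simp only [map_mul, conj_exp_I, Complex.conj_ofReal, Complex.conj_I, map_one, Function.comp_apply]
    have e1 : Complex.exp (-((k : ℂ) * θ * Complex.I)) = Complex.exp (θ * Complex.I) * Complex.exp (-(((k + 1 : ℕ) : ℂ) * θ * Complex.I)) := by
      rw [← Complex.exp_add]; congr 1; push_cast; ring
    have e2 : Complex.exp (-(((k + 2 : ℕ) : ℂ) * θ * Complex.I)) = Complex.exp (-(θ * Complex.I)) * Complex.exp (-(((k + 1 : ℕ) : ℂ) * θ * Complex.I)) := by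
      rw [← Complex.exp_add]; congr 1; push_cast; ring
    rw [e1, e2]
    ring
  have i1 : IntervalIntegrable (fun θ : ℝ => wirtingerDZ φ ((r : ℂ) * Complex.exp (θ * Complex.I)) * Complex.exp (-((k : ℂ) * θ * Complex.I))) volume (-Real.pi) Real.pi :=
    Continuous.intervalIntegrable (by fun_prop) _ _
  have i2 : IntervalIntegrable (fun θ : ℝ => wirtBar φ ((r : ℂ) * Complex.exp (θ * Complex.I)) * Complex.exp (-(((k + 2 : ℕ) : ℂ) * θ * Complex.I))) volume (-Real.pi) Real.pi :=
    Continuous.intervalIntegrable (by fun_prop) _ _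
  have i3 : IntervalIntegrable (fun θ : ℝ => φ ((r : ℂ) * Complex.exp (θ * Complex.I)) * Complex.exp (-(((k + 1 : ℕ) : ℂ) * θ * Complex.I))) volume (-Real.pi) Real.pi :=
    Continuous.intervalIntegrable (by fun_prop) _ _
  have hIntg := intervalIntegral.integral_eq_sub_of_hasDerivAt (a := -Real.pi) (b := Real.pi)
    (fun θ _ => key θ) (Continuous.intervalIntegrable (by fun_prop) _ _)
  rw [intervalIntegral.integral_const_mul, intervalIntegral.integral_sub ((i1.sub i2).const_mul _) (i3.const_mul _),
    intervalIntegral.integral_const_mul, intervalIntegral.integral_const_mul,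
    intervalIntegral.integral_sub i1 i2] at hIntg
  have hb : Complex.exp (((-Real.pi : ℝ) : ℂ) * Complex.I) = Complex.exp ((Real.pi : ℝ) * Complex.I) := by
    rw [Complex.exp_eq_exp_iff_exists_int]
    exact ⟨-1, by push_cast; ring⟩
  have hb2 : Complex.exp (-(((k + 1 : ℕ) : ℂ) * ((-Real.pi : ℝ) : ℂ) * Complex.I)) = Complex.exp (-(((k + 1 : ℕ) : ℂ) * ((Real.pi : ℝ) : ℂ) * Complex.I)) := by
    rw [Complex.exp_eq_exp_iff_exists_int]
    exact ⟨(k + 1 : ℕ), by push_cast; ring⟩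
  rw [hb, hb2, sub_self] at hIntg
  have := (mul_eq_zero.1 hIntg).resolve_left Complex.I_ne_zero
  unfold ang
  linear_combination -this

lemma ang_cont {φ : ℂ → ℂ} (hφ : Continuous φ) (k : ℕ) : Continuous (ang φ k) := by
  unfold ang
  apply intervalIntegral.continuous_parametric_intervalIntegral_of_continuous'
  fun_prop

lemma ang_deriv {φ : ℂ → ℂ} (hφ : ContDiff ℝ (⊤ : ℕ∞) φ) (k : ℕ) (r : ℝ) :
    HasDerivAt (ang φ (k + 1)) (ang (wirtingerDZ φ) k r + ang (wirtBar φ) (k + 2) r) r := by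
  have cd := (wd_smooth hφ).continuous
  have cb := (wb_smooth hφ).continuous
  have c0 := hφ.continuous
  let F' : ℝ → ℝ → ℂ := fun r θ =>
    wirtingerDZ φ ((r : ℂ) * Complex.exp (θ * Complex.I)) * Complex.exp (-((k : ℂ) * θ * Complex.I))
      + wirtBar φ ((r : ℂ) * Complex.exp (θ * Complex.I)) * Complex.exp (-(((k + 2 : ℕ) : ℂ) * θ * Complex.I))
  have cF' : Continuous (fun p : ℝ × ℝ => F' p.1 p.2) := by fun_prop
  obtain ⟨C, hC⟩ := ((isCompact_Icc (a := r - 1) (b := r + 1)).prod (isCompact_Icc (a := -Real.pi) (b := Real.pi))).exists_bound_of_continuousOn cF'.continuousOn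
  have key : ∀ r θ : ℝ, HasDerivAt (fun r : ℝ => φ ((r : ℂ) * Complex.exp (θ * Complex.I)) *
      Complex.exp (-(((k + 1 : ℕ) : ℂ) * θ * Complex.I))) (F' r θ) r := by
    intro r θ
    have h0 : HasDerivAt (fun θ : ℝ => (θ : ℂ)) 1 r := Complex.ofRealCLM.hasDerivAt
    have h1 : HasDerivAt (fun r : ℝ => (r : ℂ) * Complex.exp (θ * Complex.I))
        (1 * (Complex.exp (θ * Complex.I))) r := h0.mul_const _
    have h3 : HasFDerivAt φ (fderiv ℝ φ ((r : ℂ) * Complex.exp (θ * Complex.I))) ((r : ℂ) * Complex.exp (θ * Complex.I)) :=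
      (hφ.differentiable (by simp)).differentiableAt.hasFDerivAt
    have h4 := (h3.comp_hasDerivAt r h1).mul_const (Complex.exp (-(((k + 1 : ℕ) : ℂ) * θ * Complex.I)))
    refine h4.congr_deriv ?_
    rw [fderiv_wirt]
    simp only [map_mul, conj_exp_I, map_one, F']
    have e1 : Complex.exp (-((k : ℂ) * θ * Complex.I)) = Complex.exp (θ * Complex.I) * Complex.exp (-(((k + 1 : ℕ) : ℂ) * θ * Complex.I)) := by
      rw [← Complex.exp_add]; congr 1; push_cast; ring
    have e2 : Complex.exp (-(((k + 2 : ℕ) : ℂ) * θ * Complex.I)) = Complex.exp (-(θ * Complex.I)) * Complex.exp (-(((k + 1 : ℕ) : ℂ) * θ * Complex.I)) := by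
      rw [← Complex.exp_add]; congr 1; push_cast; ring
    rw [e1, e2]
    ring
  have hpi : -Real.pi ≤ Real.pi := by linarith [Real.pi_pos]
  have h := (intervalIntegral.hasDerivAt_integral_of_dominated_loc_of_deriv_le (μ := volume)
    (a := -Real.pi) (b := Real.pi) (bound := fun _ => C)
    (F := fun (r : ℝ) (θ : ℝ) => φ ((r : ℂ) * Complex.exp (θ * Complex.I)) *
      Complex.exp (-(((k + 1 : ℕ) : ℂ) * θ * Complex.I))) (F' := F') (x₀ := r)
    (s := Set.Icc (r - 1) (r + 1)) (Icc_mem_nhds (by linarith) (by linarith))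
    (Eventually.of_forall fun r => Continuous.aestronglyMeasurable (by fun_prop))
    (Continuous.intervalIntegrable (by fun_prop) _ _)
    (Continuous.aestronglyMeasurable (by fun_prop))
    (Eventually.of_forall fun θ hθ r' hr' => hC (r', θ) ⟨hr', by
      rw [Set.uIoc_of_le hpi] at hθ; exact ⟨hθ.1.le, hθ.2⟩⟩)
    (by simp) (Eventually.of_forall fun θ _ r' _ => key r' θ)).2
  unfold ang
  refine h.congr_deriv ?_
  simp only [F']
  rw [intervalIntegral.integral_add]
  · exact Continuous.intervalIntegrable (by fun_prop) _ _
  · exact Continuous.intervalIntegrable (by fun_prop) _ _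

lemma ang_bound (R : ℝ) (n : ℕ) : ∀ (φ : ℂ → ℂ), ContDiff ℝ (⊤ : ℕ∞) φ → ∀ k : ℕ, n ≤ k →
    ∃ C : ℝ, ∀ r ∈ Set.Icc 0 R, ‖ang φ k r‖ ≤ C * r ^ n := by
  induction n with
  | zero =>
    intro φ hφ k _
    obtain ⟨C, hC⟩ := (isCompact_Icc (a := (0 : ℝ)) (b := R)).exists_bound_of_continuousOn
      (ang_cont hφ.continuous k).continuousOn
    exact ⟨C, fun r hr => by simpa using hC r hr⟩
  | succ n ih =>
    intro φ hφ k hk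
    obtain ⟨k, rfl⟩ : ∃ j, k = j + 1 := ⟨k - 1, by omega⟩
    obtain ⟨C1, h1⟩ := ih _ (wd_smooth hφ) k (by omega)
    obtain ⟨C2, h2⟩ := ih _ (wb_smooth hφ) (k + 2) (by omega)
    refine ⟨C1 + C2, fun r hr => ?_⟩
    have hp := congrArg norm (ang_parts_s5 hφ k r)
    rw [norm_mul, norm_mul, Complex.norm_natCast, Complex.norm_real, Real.norm_of_nonneg hr.1] at hp
    have h3 := norm_sub_le (ang (wirtingerDZ φ) k r) (ang (wirtBar φ) (k + 2) r)
    have h4 : r * ‖ang (wirtingerDZ φ) k r - ang (wirtBar φ) (k + 2) r‖ ≤ r * (C1 * r ^ n + C2 * r ^ n) :=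
      mul_le_mul_of_nonneg_left (h3.trans (add_le_add (h1 r hr) (h2 r hr))) hr.1
    have h5 : (1 : ℝ) * ‖ang φ (k + 1) r‖ ≤ ((k + 1 : ℕ) : ℝ) * ‖ang φ (k + 1) r‖ := by
      gcongr
      push_cast
      linarith [(Nat.cast_nonneg k : (0 : ℝ) ≤ k)]
    calc ‖ang φ (k + 1) r‖ ≤ r * (C1 * r ^ n + C2 * r ^ n) := by linarith
      _ = _ := by ring

lemma polar_int {φ : ℂ → ℂ} (hφ : Continuous φ) {R : ℝ} (hR : ∀ z : ℂ, R ≤ ‖z‖ → φ z = 0) (k : ℕ)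
    {ε : ℝ} (hε : 0 < ε) (hεR : ε ≤ R) :
    ∫ z in {z : ℂ | ε ≤ ‖z‖}, φ z * (z ^ k)⁻¹ =
      ∫ r in ε..R, ((r : ℂ) * ((r : ℂ) ^ k)⁻¹) * ang φ k r := by
  have hms : MeasurableSet {z : ℂ | ε ≤ ‖z‖} := measurableSet_le measurable_const measurable_norm
  have hpi : -Real.pi ≤ Real.pi := by linarith [Real.pi_pos]
  rw [← integral_indicator hms, ← Complex.integral_comp_polarCoord_symm]
  set H : ℝ × ℝ → ℂ := fun p => ((p.1 : ℂ) * ((p.1 : ℂ) ^ k)⁻¹) *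
    (φ ((p.1 : ℂ) * Complex.exp (p.2 * Complex.I)) * Complex.exp (-(k * p.2 * Complex.I))) with hH
  have hsymm : ∀ p : ℝ × ℝ, Complex.polarCoord.symm p = (p.1 : ℂ) * Complex.exp (p.2 * Complex.I) := by
    intro p
    rw [Complex.polarCoord_symm_apply, Complex.exp_mul_I]
    simp
  have hsub : Set.Icc ε R ×ˢ Set.Ioo (-Real.pi) Real.pi ⊆ polarCoord.target := by
    rintro ⟨r, θ⟩ ⟨h1, h2⟩
    exact ⟨lt_of_lt_of_le hε h1.1, h2⟩
  rw [setIntegral_eq_of_subset_of_forall_sdiff_eq_zero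
    (polarCoord.open_target.measurableSet) hsub]
  · have hcongr : ∫ p in Set.Icc ε R ×ˢ Set.Ioo (-Real.pi) Real.pi, p.1 •
        ({z : ℂ | ε ≤ ‖z‖}.indicator (fun z => φ z * (z ^ k)⁻¹) (Complex.polarCoord.symm p)) =
        ∫ p in Set.Icc ε R ×ˢ Set.Ioo (-Real.pi) Real.pi, H p := by
      apply setIntegral_congr_fun (measurableSet_Icc.prod measurableSet_Ioo)
      rintro ⟨r, θ⟩ ⟨h1, h2⟩
      simp only at h1 h2
      have hr : 0 < r := lt_of_lt_of_le hε h1.1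
      have hmem : (r : ℂ) * Complex.exp (θ * Complex.I) ∈ {z : ℂ | ε ≤ ‖z‖} := by
        simp [Complex.norm_exp_ofReal_mul_I, abs_of_pos hr, h1.1]
      simp only [hsymm, hH]
      rw [Set.indicator_of_mem hmem, Complex.real_smul, mul_pow, mul_inv, ← Complex.exp_nat_mul,
        ← Complex.exp_neg]
      rw [show (k : ℂ) * (θ * Complex.I) = k * θ * Complex.I by ring]
      ring
    rw [hcongr]
    have hIntg : IntegrableOn H (Set.Icc ε R ×ˢ Set.Ioo (-Real.pi) Real.pi) (volume.prod volume) := by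
      have : IntegrableOn H (Set.Icc ε R ×ˢ Set.Icc (-Real.pi) Real.pi) (volume.prod volume) := by
        apply ContinuousOn.integrableOn_compact (isCompact_Icc.prod isCompact_Icc)
        apply ContinuousOn.mul
        · apply ContinuousOn.mul (by fun_prop)
          apply ContinuousOn.inv₀ (by fun_prop)
          rintro ⟨r, θ⟩ ⟨h1, h2⟩
          have hr : 0 < r := lt_of_lt_of_le hε h1.1
          exact pow_ne_zero _ (by exact_mod_cast hr.ne')
        · apply Continuous.continuousOn
          fun_prop
      exact this.mono_set (Set.prod_mono le_rfl Set.Ioo_subset_Icc_self)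
    rw [Measure.volume_eq_prod, setIntegral_prod _ hIntg, intervalIntegral.integral_of_le hεR,
      integral_Icc_eq_integral_Ioc]
    congr 1
    ext r
    simp only [hH, ang]
    rw [integral_const_mul, intervalIntegral.integral_of_le hpi, integral_Ioc_eq_integral_Ioo]
  · rintro ⟨r, θ⟩ ⟨⟨h1, h2⟩, h3⟩
    simp only at h1 h2
    have h1' : 0 < r := h1
    have hn : ‖(r : ℂ) * Complex.exp (θ * Complex.I)‖ = r := by
      simp [Complex.norm_exp_ofReal_mul_I, abs_of_pos h1']
    simp only [hsymm]
    by_cases hr : ε ≤ r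
    · have : R ≤ r := by
        by_contra hcon
        exact h3 ⟨⟨hr, (not_le.1 hcon).le⟩, h2⟩
      rw [Set.indicator_of_mem (by rw [Set.mem_ofPred_eq, hn]; exact hr), hR _ (by rw [hn]; exact this)]
      simp
    · rw [Set.indicator_of_notMem (by rw [Set.mem_ofPred_eq, hn]; exact hr)]
      simp

lemma area_int {φ : ℂ → ℂ} (hφ : Continuous φ) {R : ℝ} (hR : ∀ z : ℂ, R ≤ ‖z‖ → φ z = 0) (k : ℕ)
    {ε : ℝ} (hε : 0 < ε) :
    IntegrableOn (fun z => φ z * (z ^ k)⁻¹) {z : ℂ | ε ≤ ‖z‖} := by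
  have hms : MeasurableSet {z : ℂ | ε ≤ ‖z‖} := measurableSet_le measurable_const measurable_norm
  have hcl : IsClosed {z : ℂ | ε ≤ ‖z‖} := isClosed_le continuous_const continuous_norm
  have hK : IsCompact ({z : ℂ | ε ≤ ‖z‖} ∩ Metric.closedBall 0 R) :=
    (isCompact_closedBall (0 : ℂ) R).inter_left hcl
  have h1 : IntegrableOn (fun z => φ z * (z ^ k)⁻¹) ({z : ℂ | ε ≤ ‖z‖} ∩ Metric.closedBall 0 R) := by
    apply ContinuousOn.integrableOn_compact hK
    apply ContinuousOn.mul hφ.continuousOn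
    apply ContinuousOn.inv₀ (by fun_prop)
    rintro z ⟨h1, _⟩
    have h1' : ε ≤ ‖z‖ := h1
    exact pow_ne_zero _ (norm_pos_iff.1 (lt_of_lt_of_le hε h1'))
  refine h1.of_forall_sdiff_eq_zero hms ?_
  rintro z ⟨h2, h3⟩
  have : R ≤ ‖z‖ := by
    by_contra hcon
    exact h3 ⟨h2, by simpa using (not_le.1 hcon).le⟩
  simp [hR z this]

lemma lim_exists {φ : ℂ → ℂ} (hφ : ContDiff ℝ (⊤ : ℕ∞) φ) {R : ℝ} (hRp : 0 < R)
    (hR : ∀ z : ℂ, R ≤ ‖z‖ → φ z = 0) (k : ℕ) :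
    ∃ L : ℂ, Tendsto (fun ε : ℝ => ∫ z in {z : ℂ | ε ≤ ‖z‖}, φ z * (z ^ k)⁻¹) (𝓝[>] (0 : ℝ)) (𝓝 L) := by
  set G : ℝ → ℂ := fun r => ((r : ℂ) * ((r : ℂ) ^ k)⁻¹) * ang φ k r with hG
  obtain ⟨C, hC⟩ := ang_bound R k φ hφ k le_rfl
  have hIntg : IntegrableOn G (Set.Ioc 0 R) := by
    apply Measure.integrableOn_of_bounded (M := R * C)
    · simp
    · apply Measurable.aestronglyMeasurable
      have := (ang_cont hφ.continuous k).measurable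
      fun_prop
    · rw [ae_restrict_iff' measurableSet_Ioc]
      refine Eventually.of_forall fun r hr => ?_
      have hrk : 0 < r ^ k := pow_pos hr.1 k
      have h := hC r ⟨hr.1.le, hr.2⟩
      have hC0 : 0 ≤ C := by
        by_contra hcon
        have := mul_neg_of_neg_of_pos (not_le.1 hcon) hrk
        linarith [norm_nonneg (ang φ k r)]
      simp only [hG, norm_mul, norm_inv, norm_pow, Complex.norm_real, Real.norm_of_nonneg hr.1.le]
      calc r * (r ^ k)⁻¹ * ‖ang φ k r‖ ≤ r * (r ^ k)⁻¹ * (C * r ^ k) := by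
            have := hr.1
            gcongr
        _ = r * C := by field_simp
        _ ≤ R * C := by gcongr; exact hr.2
  have hIntg' : IntegrableOn G (Set.uIcc 0 R) := by
    rw [Set.uIcc_of_le hRp.le, integrableOn_Icc_iff_integrableOn_Ioc]; exact hIntg
  have hc := intervalIntegral.continuousOn_primitive_interval_left hIntg' 0 Set.left_mem_uIcc
  refine ⟨∫ r in (0 : ℝ)..R, G r, ?_⟩
  have hc' : Tendsto (fun x => ∫ r in x..R, G r) (𝓝[Set.Ioo 0 R] 0) (𝓝 (∫ r in (0 : ℝ)..R, G r)) :=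
    hc.mono_left (nhdsWithin_mono _ (by rw [Set.uIcc_of_le hRp.le]; exact Set.Ioo_subset_Icc_self))
  rw [nhdsWithin_Ioo_eq_nhdsGT hRp] at hc'
  refine hc'.congr' ?_
  filter_upwards [Ioo_mem_nhdsGT hRp] with ε hε
  exact (polar_int hφ.continuous hR k hε.1 hε.2.le).symm

lemma boundary {h : ℂ → ℂ} (hh : ContDiff ℝ (⊤ : ℕ∞) h) {R : ℝ} (hRp : 0 < R)
    (hR : ∀ z : ℂ, R ≤ ‖z‖ → h z = 0) (hR' : ∀ z : ℂ, R ≤ ‖z‖ → wirtingerDZ h z = 0) (m : ℕ) :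
    Tendsto (fun ε : ℝ => (∫ z in {z : ℂ | ε ≤ ‖z‖}, wirtingerDZ h z * (z ^ m)⁻¹)
      - m * ∫ z in {z : ℂ | ε ≤ ‖z‖}, h z * (z ^ (m + 1))⁻¹) (𝓝[>] (0 : ℝ)) (𝓝 0) := by
  set P : ℝ → ℂ := fun r => (1 / 2 : ℂ) * (((r : ℂ) * ((r : ℂ) ^ m)⁻¹) * ang h (m + 1) r) with hP
  have hder : ∀ r : ℝ, 0 < r → HasDerivAt P (((r : ℂ) * ((r : ℂ) ^ m)⁻¹) * ang (wirtingerDZ h) m r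
      - m * (((r : ℂ) * ((r : ℂ) ^ (m + 1))⁻¹) * ang h (m + 1) r)) r := by
    intro r hr
    have hr0 : (r : ℂ) ≠ 0 := by exact_mod_cast hr.ne'
    have h0 : HasDerivAt (fun θ : ℝ => (θ : ℂ)) 1 r := Complex.ofRealCLM.hasDerivAt
    have h1 := ((h0.mul ((h0.pow m).inv (pow_ne_zero m hr0))).mul (ang_deriv hh m r)).const_mul (1 / 2 : ℂ)
    refine h1.congr_deriv ?_
    have hp := ang_parts_s5 hh m r
    have hp' : (r : ℂ) * ang (wirtBar h) (m + 2) r = r * ang (wirtingerDZ h) m r - ((m + 1 : ℕ) : ℂ) * ang h (m + 1) r := by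
      linear_combination hp
    have hp2 : ang (wirtBar h) (m + 2) r = ang (wirtingerDZ h) m r - ((m + 1 : ℕ) : ℂ) * ang h (m + 1) r / r := by
      field_simp
      linear_combination hp'
    rw [hp2]
    simp only [Pi.mul_apply, Pi.inv_apply, Pi.pow_apply]
    rcases m with _ | m
    · simp; field_simp; ring
    · simp only [Nat.add_sub_cancel]
      push_cast
      field_simp
      ring
  have heq : ∀ ε ∈ Set.Ioo 0 R, (∫ z in {z : ℂ | ε ≤ ‖z‖}, wirtingerDZ h z * (z ^ m)⁻¹)
      - m * ∫ z in {z : ℂ | ε ≤ ‖z‖}, h z * (z ^ (m + 1))⁻¹ = - P ε := by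
    intro ε hε
    rw [polar_int (wd_smooth hh).continuous hR' m hε.1 hε.2.le, polar_int hh.continuous hR (m + 1) hε.1 hε.2.le]
    have hcont : ∀ (j : ℕ) (ψ : ℂ → ℂ) (l : ℕ), Continuous ψ →
        IntervalIntegrable (fun r : ℝ => ((r : ℂ) * ((r : ℂ) ^ j)⁻¹) * ang ψ l r) volume ε R := by
      intro j ψ l hψ
      apply ContinuousOn.intervalIntegrable
      apply ContinuousOn.mul _ (ang_cont hψ l).continuousOn
      apply ContinuousOn.mul (by fun_prop)
      apply ContinuousOn.inv₀ (by fun_prop)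
      intro r hr
      rw [Set.uIcc_of_le hε.2.le] at hr
      have : 0 < r := lt_of_lt_of_le hε.1 hr.1
      exact pow_ne_zero _ (by exact_mod_cast this.ne')
    have i1 := hcont m _ m (wd_smooth hh).continuous
    have i2 := (hcont (m + 1) _ (m + 1) hh.continuous).const_mul (m : ℂ)
    rw [← intervalIntegral.integral_const_mul, ← intervalIntegral.integral_sub i1 i2,
      intervalIntegral.integral_eq_sub_of_hasDerivAt (f := P) _ (i1.sub i2)]
    · have : ang h (m + 1) R = 0 := by
        unfold ang
        have : ∀ θ : ℝ, h ((R : ℂ) * Complex.exp (θ * Complex.I)) = 0 := by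
          intro θ
          apply hR
          simp [Complex.norm_exp_ofReal_mul_I, abs_of_pos hRp]
        simp [this]
      simp [hP, this]
    · intro r hr
      rw [Set.uIcc_of_le hε.2.le] at hr
      exact hder r (lt_of_lt_of_le hε.1 hr.1)
  obtain ⟨C, hC⟩ := ang_bound R (m + 1) h hh (m + 1) le_rfl
  have hlim : Tendsto (fun ε : ℝ => (1 / 2 : ℝ) * (C * ε ^ 2)) (𝓝[>] (0 : ℝ)) (𝓝 0) := by
    have : Tendsto (fun ε : ℝ => (1 / 2 : ℝ) * (C * ε ^ 2)) (𝓝 (0 : ℝ)) (𝓝 ((1 / 2 : ℝ) * (C * 0 ^ 2))) :=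
      Continuous.tendsto (by fun_prop) _
    simp only [ne_eq, OfNat.ofNat_ne_zero, not_false_eq_true, zero_pow, mul_zero] at this
    exact this.mono_left nhdsWithin_le_nhds
  refine squeeze_zero_norm' ?_ hlim
  filter_upwards [Ioo_mem_nhdsGT hRp] with ε hε
  rw [heq ε hε, norm_neg]
  have hb := hC ε ⟨hε.1.le, hε.2.le⟩
  have hε0 := hε.1
  simp only [hP, norm_mul, norm_inv, norm_pow, Complex.norm_real, Real.norm_of_nonneg hε.1.le]
  calc ‖(1 / 2 : ℂ)‖ * (ε * (ε ^ m)⁻¹ * ‖ang h (m + 1) ε‖)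
      ≤ ‖(1 / 2 : ℂ)‖ * (ε * (ε ^ m)⁻¹ * (C * ε ^ (m + 1))) := by gcongr
    _ = (1 / 2 : ℝ) * (C * ε ^ 2) := by
      rw [show ‖(1 / 2 : ℂ)‖ = 1 / 2 by simp]
      field_simp
      ring

lemma wd_mul {a b : ℂ → ℂ} {z : ℂ} (ha : DifferentiableAt ℝ a z) (hb : DifferentiableAt ℝ b z) :
    wirtingerDZ (fun w => a w * b w) z = a z * wirtingerDZ b z + b z * wirtingerDZ a z := by
  unfold wirtingerDZ
  rw [fderiv_fun_mul ha hb]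
  simp
  ring

lemma wd_zpow {z : ℂ} (hz : z ≠ 0) (m : ℕ) :
    wirtingerDZ (fun w => w ^ (-(m : ℤ))) z = -m * (z ^ (m + 1))⁻¹ := by
  have h := ((hasDerivAt_zpow (-(m : ℤ)) z (Or.inl hz)).hasFDerivAt.restrictScalars ℝ).fderiv
  have e : z ^ (-(m : ℤ) - 1) = (z ^ (m + 1))⁻¹ := by
    rw [← zpow_natCast, ← zpow_neg]; congr 1; push_cast; ring
  unfold wirtingerDZ
  rw [h]
  simp only [ContinuousLinearMap.coe_restrictScalars', ContinuousLinearMap.toSpanSingleton_apply, smul_eq_mul, e]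
  push_cast
  linear_combination (1 / 2 : ℂ) * (m * (z ^ (m + 1))⁻¹) * Complex.I_sq

/-- For `g` smooth, `f` smooth with compact support and `m ≥ 1`, the radial
principal values `L₁` of `f z · ∂_z(g z · z^{-m})` and `L₂` of `g z · z^{-m} · ∂_z f z`
both exist and `L₁ + L₂ = 0`. -/
theorem stmt_5 (g f : ℂ → ℂ) (hg : ContDiff ℝ (⊤ : ℕ∞) g)
    (hf : ContDiff ℝ (⊤ : ℕ∞) f) (hfc : HasCompactSupport f)
    (m : ℕ) (hm : 1 ≤ m) :
    ∃ L₁ L₂ : ℂ,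
      Tendsto (fun ε : ℝ => ∫ z in {z : ℂ | ε ≤ ‖z‖},
          f z * wirtingerDZ (fun w : ℂ => g w * w ^ (-(m : ℤ))) z)
        (𝓝[>] (0 : ℝ)) (𝓝 L₁) ∧
      Tendsto (fun ε : ℝ => ∫ z in {z : ℂ | ε ≤ ‖z‖},
          g z * z ^ (-(m : ℤ)) * wirtingerDZ f z)
        (𝓝[>] (0 : ℝ)) (𝓝 L₂) ∧
      L₁ + L₂ = 0 := by
  obtain ⟨R0, hR0⟩ := hfc.isCompact.isBounded.subset_closedBall (0 : ℂ)
  set R : ℝ := max R0 0 + 1 with hRdef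
  have hRp : 0 < R := by positivity
  have hts : ∀ z : ℂ, R ≤ ‖z‖ → z ∉ tsupport f := by
    intro z hz hmem
    have := hR0 hmem
    rw [mem_closedBall_zero_iff] at this
    linarith [le_max_left R0 0]
  have hfz : ∀ z : ℂ, R ≤ ‖z‖ → f z = 0 := fun z hz => image_eq_zero_of_notMem_tsupport (hts z hz)
  have hdfz : ∀ z : ℂ, R ≤ ‖z‖ → wirtingerDZ f z = 0 := by
    intro z hz
    have : fderiv ℝ f z = 0 := by
      by_contra hcon
      exact hts z hz (support_fderiv_subset ℝ hcon)
    simp [wirtingerDZ, this]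
  have hfd : ∀ z, DifferentiableAt ℝ f z := fun z => (hf.differentiable (by simp)).differentiableAt
  have hgd : ∀ z, DifferentiableAt ℝ g z := fun z => (hg.differentiable (by simp)).differentiableAt
  have s1 : ContDiff ℝ (⊤ : ℕ∞) (fun z => f z * wirtingerDZ g z) := hf.mul (wd_smooth hg)
  have s2 : ContDiff ℝ (⊤ : ℕ∞) (fun z => g z * wirtingerDZ f z) := hg.mul (wd_smooth hf)
  have s3 : ContDiff ℝ (⊤ : ℕ∞) (fun z => f z * g z) := hf.mul hg
  have z1 : ∀ z : ℂ, R ≤ ‖z‖ → f z * wirtingerDZ g z = 0 := fun z hz => by simp [hfz z hz]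
  have z2 : ∀ z : ℂ, R ≤ ‖z‖ → g z * wirtingerDZ f z = 0 := fun z hz => by simp [hdfz z hz]
  have z3 : ∀ z : ℂ, R ≤ ‖z‖ → f z * g z = 0 := fun z hz => by simp [hfz z hz]
  have hprod : ∀ z, wirtingerDZ (fun z => f z * g z) z = f z * wirtingerDZ g z + g z * wirtingerDZ f z :=
    fun z => wd_mul (hfd z) (hgd z)
  have z4 : ∀ z : ℂ, R ≤ ‖z‖ → wirtingerDZ (fun z => f z * g z) z = 0 := fun z hz => by
    rw [hprod, z1 z hz, z2 z hz, add_zero]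
  obtain ⟨A, hA⟩ := lim_exists s1 hRp z1 m
  obtain ⟨B, hB⟩ := lim_exists s3 hRp z3 (m + 1)
  obtain ⟨D, hD⟩ := lim_exists s2 hRp z2 m
  have hbd := boundary s3 hRp z3 z4 m
  have hms : ∀ ε : ℝ, MeasurableSet {z : ℂ | ε ≤ ‖z‖} := fun ε =>
    measurableSet_le measurable_const measurable_norm
  have e1 : ∀ ε : ℝ, 0 < ε → ∫ z in {z : ℂ | ε ≤ ‖z‖},
      f z * wirtingerDZ (fun w : ℂ => g w * w ^ (-(m : ℤ))) z =
      (∫ z in {z : ℂ | ε ≤ ‖z‖}, f z * wirtingerDZ g z * (z ^ m)⁻¹) -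
        m * ∫ z in {z : ℂ | ε ≤ ‖z‖}, f z * g z * (z ^ (m + 1))⁻¹ := by
    intro ε hε
    rw [← integral_const_mul, ← integral_sub (area_int s1.continuous z1 m hε)
      ((area_int s3.continuous z3 (m + 1) hε).const_mul _)]
    apply setIntegral_congr_fun (hms ε)
    intro z hz
    have hz' : ε ≤ ‖z‖ := hz
    have hz0 : z ≠ 0 := norm_pos_iff.1 (lt_of_lt_of_le hε hz')
    have hd : DifferentiableAt ℝ (fun w : ℂ => w ^ (-(m : ℤ))) z :=
      (differentiableAt_zpow.2 (Or.inl hz0)).restrictScalars ℝ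
    simp only
    rw [wd_mul (hgd z) hd, wd_zpow hz0, zpow_neg, zpow_natCast]
    ring
  have e2 : ∀ ε : ℝ, ∫ z in {z : ℂ | ε ≤ ‖z‖}, g z * z ^ (-(m : ℤ)) * wirtingerDZ f z =
      ∫ z in {z : ℂ | ε ≤ ‖z‖}, g z * wirtingerDZ f z * (z ^ m)⁻¹ := by
    intro ε
    congr 1
    ext z
    rw [zpow_neg, zpow_natCast]
    ring
  refine ⟨A - m * B, D, ?_, ?_, ?_⟩
  · refine (hA.sub (hB.const_mul (m : ℂ))).congr' ?_
    filter_upwards [self_mem_nhdsWithin] with ε hε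
    exact (e1 ε hε).symm
  · simpa only [e2] using hD
  · refine tendsto_nhds_unique (((hA.sub (hB.const_mul (m : ℂ))).add hD).congr' ?_) hbd
    filter_upwards [self_mem_nhdsWithin] with ε hε
    simp only [hprod, add_mul]
    rw [integral_add (area_int s1.continuous z1 m hε) (area_int s2.continuous z2 m hε)]
    ring
end

section
/- Let g : ℂ × ℂ → ℂ be smooth (infinitely differentiable over ℝ, viewing ℂ × ℂ as ℝ⁴) with compact support, and let m ≥ 1 be a natural number. Then: (a) for every w : ℂ the limit h(w) := lim_{ε→0⁺} ∫_{{z : ℂ | ε ≤ ‖z − w‖}} g(z, w)/(z − w)^m dA(z) exists; (b) for every z : ℂ the limit k(z) := lim_{ε→0⁺} ∫_{{w : ℂ | ε ≤ ‖z − w‖}} g(z, w)/(z − w)^m dA(w) exists; (c) h and k are integrable on ℂ and ∫_ℂ h(w) dA(w) = ∫_ℂ k(z) dA(z). -/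
open MeasureTheory Filter Topology

namespace RegFubini

/-- Twisted sum over the rotations by powers of `ζ`. -/
noncomputable def Q (ζ : ℂ) (N : ℕ) (b : ℤ) (G : ℂ × ℂ → ℂ) (q : ℂ × ℂ) : ℂ :=
  ∑ k ∈ Finset.range N, (ζ ^ b) ^ k * G (ζ ^ k * q.1, q.2)

lemma real_linear (L : ℂ × ℂ →L[ℝ] ℂ) (v : ℂ) :
    L (v, 0) = v * ((L (1, 0) - Complex.I * L (Complex.I, 0)) / 2)
      + (starRingEnd ℂ v) * ((L (1, 0) + Complex.I * L (Complex.I, 0)) / 2) := by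
  have h : ((v, 0) : ℂ × ℂ) = v.re • ((1 : ℂ), (0 : ℂ)) + v.im • (Complex.I, (0 : ℂ)) := by
    ext <;> simp
  have h2 : L (v, 0) = v.re * L (1, 0) + v.im * L (Complex.I, 0) := by
    rw [h, map_add, map_smul, map_smul]; simp
  rw [h2]
  have e1 : v = v.re + v.im * Complex.I := (Complex.re_add_im v).symm
  have e2 : (starRingEnd ℂ v) = v.re - v.im * Complex.I := by
    apply Complex.ext <;> simp
  rw [e2]
  generalize L (1, 0) = A
  generalize L (Complex.I, 0) = B
  have e3 : v * ((A - Complex.I * B) / 2) = (v.re + v.im * Complex.I) * ((A - Complex.I * B) / 2) := by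
    rw [← e1]
  rw [e3]
  linear_combination ((v.im : ℂ) * B) * Complex.I_sq

lemma bound (ζ : ℂ) (N : ℕ) (hζ : ‖ζ‖ = 1) (hN : ζ ^ N = 1) (j : ℕ) :
    ∀ (b : ℤ) (_ : ∀ i : ℤ, |i| < j → ζ ^ (b + i) ≠ 1) (G : ℂ × ℂ → ℂ)
      (_ : ContDiff ℝ (⊤ : ℕ∞) G) (_ : HasCompactSupport G),
      ∃ C : ℝ, 0 ≤ C ∧ ∀ q, ‖Q ζ N b G q‖ ≤ C * ‖q.1‖ ^ j := by
  have hζ0 : ζ ≠ 0 := by rintro rfl; simp at hζ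
  induction j with
  | zero =>
    intro b _ G hG hGc
    obtain ⟨C, hC⟩ := hG.continuous.bounded_above_of_compact_support hGc
    have hC0 : 0 ≤ C := (norm_nonneg _).trans (hC 0)
    refine ⟨N * C, by positivity, fun q => ?_⟩
    simp only [pow_zero, mul_one, Q]
    refine (norm_sum_le _ _).trans ?_
    calc _ ≤ ∑ k ∈ Finset.range N, C := by
          apply Finset.sum_le_sum
          intro k _
          simp only [norm_mul, norm_pow, norm_zpow, hζ, one_zpow, one_pow, one_mul]
          exact hC _
      _ = _ := by simp
  | succ j ih =>
    intro b hb G hG hGc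
    set D : ℂ → ℂ × ℂ → ℂ := fun v q => fderiv ℝ G q (v, 0) with hD
    have hDs : ∀ v, ContDiff ℝ (⊤ : ℕ∞) (D v) := by
      intro v
      have := hG.fderiv_right (m := (⊤ : ℕ∞)) (by simp)
      exact this.clm_apply contDiff_const
    have hDc : ∀ v, HasCompactSupport (D v) := fun v => hGc.fderiv_apply ℝ (v, 0)
    set A : ℂ × ℂ → ℂ := fun q => (D 1 q - Complex.I * D Complex.I q) / 2 with hA
    set B : ℂ × ℂ → ℂ := fun q => (D 1 q + Complex.I * D Complex.I q) / 2 with hB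
    have hAs : ContDiff ℝ (⊤ : ℕ∞) A :=
      ((hDs 1).sub (contDiff_const.mul (hDs _))).div_const _
    have hBs : ContDiff ℝ (⊤ : ℕ∞) B :=
      ((hDs 1).add (contDiff_const.mul (hDs _))).div_const _
    have key : ∀ q, q ∉ tsupport G → D 1 q = 0 ∧ D Complex.I q = 0 := by
      intro q hq
      have : fderiv ℝ G q = 0 := by
        by_contra h
        exact hq (support_fderiv_subset ℝ h)
      simp [hD, this]
    have hAc : HasCompactSupport A := by
      refine HasCompactSupport.intro hGc (fun q hq => ?_)
      simp [hA, key q hq]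
    have hBc : HasCompactSupport B := by
      refine HasCompactSupport.intro hGc (fun q hq => ?_)
      simp [hB, key q hq]
    obtain ⟨C1, hC1, h1⟩ := ih (b + 1) (by
      intro i hi
      have := hb (1 + i) (by
        have := abs_add_le 1 i
        push_cast
        simp only [abs_one] at this
        omega)
      rwa [← add_assoc] at this) A hAs hAc
    obtain ⟨C2, hC2, h2⟩ := ih (b - 1) (by
      intro i hi
      have := hb (-1 + i) (by
        have := abs_add_le (-1) i
        push_cast
        simp only [abs_neg, abs_one] at this
        omega)
      rwa [← add_assoc] at this) B hBs hBc
    refine ⟨C1 + C2, by positivity, fun q => ?_⟩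
    obtain ⟨u, p⟩ := q
    have hder : ∀ t : ℝ, HasDerivAt (fun t : ℝ => Q ζ N b G ((t : ℂ) * u, p))
        (u * Q ζ N (b + 1) A ((t : ℂ) * u, p)
          + (starRingEnd ℂ u) * Q ζ N (b - 1) B ((t : ℂ) * u, p)) t := by
      intro t
      have hd : ∀ k : ℕ, HasDerivAt (fun t : ℝ => (ζ ^ b) ^ k * G (ζ ^ k * ((t : ℂ) * u), p))
          ((ζ ^ b) ^ k * D (ζ ^ k * u) (ζ ^ k * ((t : ℂ) * u), p)) t := by
        intro k
        have h1 : HasDerivAt (fun t : ℝ => (ζ ^ k * ((t : ℂ) * u), p)) (ζ ^ k * u, 0) t := by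
          refine HasDerivAt.prodMk ?_ (hasDerivAt_const _ _)
          have := ((Complex.ofRealCLM.hasDerivAt (x := t)).mul_const u).const_mul (ζ ^ k)
          simpa using this
        have h2 := ((hG.differentiable (by simp)) (ζ ^ k * ((t : ℂ) * u), p)).hasFDerivAt
        exact (h2.comp_hasDerivAt t h1).const_mul _
      have hs := HasDerivAt.fun_sum (u := Finset.range N) (fun k _ => hd k)
      have : (u * Q ζ N (b + 1) A ((t : ℂ) * u, p)
          + (starRingEnd ℂ u) * Q ζ N (b - 1) B ((t : ℂ) * u, p))
          = ∑ k ∈ Finset.range N, (ζ ^ b) ^ k * D (ζ ^ k * u) (ζ ^ k * ((t : ℂ) * u), p) := by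
        simp only [Q, Finset.mul_sum, ← Finset.sum_add_distrib]
        refine Finset.sum_congr rfl (fun k _ => ?_)
        have hl := real_linear (fderiv ℝ G (ζ ^ k * ((t : ℂ) * u), p)) (ζ ^ k * u)
        simp only [hD, hl, hA, hB]
        have hcon : (starRingEnd ℂ) ζ = ζ⁻¹ := (Complex.inv_eq_conj hζ).symm
        rw [map_mul, map_pow, hcon, zpow_add₀ hζ0, zpow_sub₀ hζ0, zpow_one,
          div_eq_mul_inv (ζ ^ b) ζ, mul_pow, mul_pow]
        ring
      rw [this]
      exact hs
    have h0 : Q ζ N b G (((0 : ℝ) : ℂ) * u, p) = 0 := by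
      simp only [Q, Complex.ofReal_zero, zero_mul, mul_zero]
      rw [← Finset.sum_mul]
      have hne : ζ ^ b ≠ 1 := by simpa using hb 0 (by simp)
      rw [geom_sum_eq hne, ← zpow_natCast, zpow_comm, zpow_natCast, hN]
      simp
    have hmv := norm_image_sub_le_of_norm_deriv_le_segment_01'
      (f := fun t : ℝ => Q ζ N b G ((t : ℂ) * u, p))
      (C := (C1 + C2) * ‖u‖ ^ (j + 1))
      (fun t _ => (hder t).hasDerivWithinAt) (by
        intro t ht
        have hle : ‖(t : ℂ) * u‖ ^ j ≤ ‖u‖ ^ j := by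
          gcongr
          rw [norm_mul, Complex.norm_real, Real.norm_of_nonneg ht.1]
          exact mul_le_of_le_one_left (norm_nonneg _) ht.2.le
        refine (norm_add_le _ _).trans ?_
        rw [norm_mul, norm_mul, RCLike.norm_conj]
        have e1 := (h1 ((t : ℂ) * u, p)).trans (mul_le_mul_of_nonneg_left hle hC1)
        have e2 := (h2 ((t : ℂ) * u, p)).trans (mul_le_mul_of_nonneg_left hle hC2)
        calc _ ≤ ‖u‖ * (C1 * ‖u‖ ^ j) + ‖u‖ * (C2 * ‖u‖ ^ j) := by gcongr
          _ = _ := by ring)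
    rw [h0] at hmv
    simpa using hmv

/-- The regularized kernel. -/
noncomputable def S (ζ : ℂ) (N m : ℕ) (G : ℂ × ℂ → ℂ) (q : ℂ × ℂ) : ℂ :=
  (N : ℂ)⁻¹ * (Q ζ N (-m) G q / q.1 ^ m)

lemma S_bound (ζ : ℂ) (m : ℕ) (hm : 1 ≤ m) (hζ : IsPrimitiveRoot ζ (2 * m)) (G : ℂ × ℂ → ℂ)
    (hG : ContDiff ℝ (⊤ : ℕ∞) G) (hGc : HasCompactSupport G) :
    ∃ C R : ℝ, ∀ q, ‖S ζ (2 * m) m G q‖ ≤ (Metric.closedBall (0 : ℂ × ℂ) R).indicator (fun _ => C) q := by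
  have hn : ‖ζ‖ = 1 := hζ.norm'_eq_one (by omega)
  obtain ⟨C, hC, hb⟩ := bound ζ (2 * m) hn hζ.pow_eq_one m (-m) (by
    intro i hi h
    rw [hζ.zpow_eq_one_iff_dvd] at h
    rw [abs_lt] at hi
    obtain ⟨c, hc⟩ := h
    push_cast at hc
    have h1 : c < 0 := by nlinarith
    have h2 : -1 < c := by nlinarith
    omega) G hG hGc
  obtain ⟨R, hR⟩ := hGc.isCompact.isBounded.subset_closedBall (0 : ℂ × ℂ)
  refine ⟨(2 * m : ℝ)⁻¹ * C, R, fun q => ?_⟩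
  by_cases hq : q ∈ Metric.closedBall (0 : ℂ × ℂ) R
  · rw [Set.indicator_of_mem hq, S, norm_mul, norm_div, norm_pow]
    have : ‖((2 * m : ℕ) : ℂ)⁻¹‖ = (2 * m : ℝ)⁻¹ := by simp
    rw [this]
    gcongr
    exact div_le_of_le_mul₀ (by positivity) hC (hb q)
  · rw [Set.indicator_of_notMem hq]
    have : Q ζ (2 * m) (-m) G q = 0 := by
      apply Finset.sum_eq_zero
      intro k _
      have : G (ζ ^ k * q.1, q.2) = 0 := by
        apply image_eq_zero_of_notMem_tsupport
        intro h
        apply hq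
        have := hR h
        simpa [Prod.norm_def, hn] using this
      rw [this, mul_zero]
    simp [S, this]

lemma Q_cont (ζ : ℂ) (N : ℕ) (b : ℤ) (G : ℂ × ℂ → ℂ) (hG : Continuous G) :
    Continuous (Q ζ N b G) := by
  unfold Q
  fun_prop

lemma S_meas (ζ : ℂ) (N m : ℕ) (G : ℂ × ℂ → ℂ) (hG : Continuous G) :
    Measurable (S ζ N m G) := by
  unfold S
  have := (Q_cont ζ N (-m) G hG).measurable
  fun_prop

lemma S_int (ζ : ℂ) (m : ℕ) (hm : 1 ≤ m) (hζ : IsPrimitiveRoot ζ (2 * m)) (G : ℂ × ℂ → ℂ)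
    (hG : ContDiff ℝ (⊤ : ℕ∞) G) (hGc : HasCompactSupport G) :
    Integrable (S ζ (2 * m) m G) ((volume : Measure ℂ).prod volume) := by
  obtain ⟨C, R, h⟩ := S_bound ζ m hm hζ G hG hGc
  refine Integrable.mono' (g := (Metric.closedBall (0 : ℂ × ℂ) R).indicator (fun _ => C)) ?_
    (S_meas ζ _ m G hG.continuous).aestronglyMeasurable (ae_of_all _ h)
  rw [integrable_indicator_iff measurableSet_closedBall]
  refine integrableOn_const ?_
  exact ((isCompact_closedBall (0 : ℂ × ℂ) R).measure_lt_top
    (μ := ((volume : Measure ℂ).prod volume))).ne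

lemma S_int1 (ζ : ℂ) (m : ℕ) (hm : 1 ≤ m) (hζ : IsPrimitiveRoot ζ (2 * m)) (G : ℂ × ℂ → ℂ)
    (hG : ContDiff ℝ (⊤ : ℕ∞) G) (hGc : HasCompactSupport G) (p : ℂ) :
    Integrable (fun u => S ζ (2 * m) m G (u, p)) := by
  obtain ⟨C, R, h⟩ := S_bound ζ m hm hζ G hG hGc
  refine Integrable.mono' (g := (Metric.closedBall (0 : ℂ) R).indicator (fun _ => |C|)) ?_
    ((S_meas ζ _ m G hG.continuous).comp measurable_prodMk_right).aestronglyMeasurable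
    (ae_of_all _ fun u => (h (u, p)).trans ?_)
  · rw [integrable_indicator_iff measurableSet_closedBall]
    exact integrableOn_const (isCompact_closedBall (0 : ℂ) R).measure_lt_top.ne
  · by_cases hq : (u, p) ∈ Metric.closedBall (0 : ℂ × ℂ) R
    · have : u ∈ Metric.closedBall (0 : ℂ) R := by
        simp [Prod.norm_def] at hq ⊢; exact hq.1
      rw [Set.indicator_of_mem hq, Set.indicator_of_mem this]
      exact le_abs_self C
    · rw [Set.indicator_of_notMem hq]
      exact Set.indicator_nonneg (fun _ _ => abs_nonneg C) _

lemma meas_set (ε : ℝ) : MeasurableSet {u : ℂ | ε ≤ ‖u‖} :=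
  measurableSet_le measurable_const measurable_norm

lemma slice_int (G : ℂ × ℂ → ℂ) (hG : Continuous G) (hGc : HasCompactSupport G) (p : ℂ) :
    Integrable (fun u => G (u, p)) := by
  refine Continuous.integrable_of_hasCompactSupport (by fun_prop) ?_
  refine HasCompactSupport.intro (hGc.isCompact.image continuous_fst) (fun u hu => ?_)
  apply image_eq_zero_of_notMem_tsupport
  exact fun h => hu ⟨_, h, rfl⟩

lemma rot_int (a : ℂ) (ha : ‖a‖ = 1) (F : ℂ → ℂ) : ∫ u, F (a * u) = ∫ u, F u := by
  let c : Circle := ⟨a, by simpa [Submonoid.unitSphere] using ha⟩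
  have h := (rotation c).measurePreserving
  exact h.integral_comp (rotation c).toHomeomorph.measurableEmbedding F

lemma rot_integrable (a : ℂ) (ha : ‖a‖ = 1) (F : ℂ → ℂ) (hF : Integrable F) :
    Integrable (fun u => F (a * u)) := by
  let c : Circle := ⟨a, by simpa [Submonoid.unitSphere] using ha⟩
  have h := (rotation c).measurePreserving
  exact (h.integrable_comp_emb (rotation c).toHomeomorph.measurableEmbedding).2 hF

lemma cut_integrable (G : ℂ × ℂ → ℂ) (hG : Continuous G) (hGc : HasCompactSupport G) (p : ℂ)
    (m : ℕ) (ε : ℝ) (hε : 0 < ε) :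
    Integrable ({u : ℂ | ε ≤ ‖u‖}.indicator (fun u => G (u, p) / u ^ m)) := by
  have h := (slice_int G hG hGc p).norm.mul_const ((ε ^ m)⁻¹)
  refine Integrable.mono' h ?_ (ae_of_all _ fun u => ?_)
  · apply Measurable.aestronglyMeasurable
    refine Measurable.indicator ?_ (meas_set ε)
    have : Measurable (fun u => G (u, p)) := (by fun_prop : Continuous _).measurable
    fun_prop
  · by_cases hu : u ∈ {u : ℂ | ε ≤ ‖u‖}
    · rw [Set.indicator_of_mem hu, norm_div, norm_pow, div_eq_mul_inv]
      have : ε ≤ ‖u‖ := hu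
      gcongr
    · rw [Set.indicator_of_notMem hu]
      simp only [norm_zero]
      positivity

lemma cut_eq (ζ : ℂ) (m : ℕ) (hm : 1 ≤ m) (hζ : IsPrimitiveRoot ζ (2 * m)) (G : ℂ × ℂ → ℂ)
    (hG : ContDiff ℝ (⊤ : ℕ∞) G) (hGc : HasCompactSupport G) (p : ℂ) (ε : ℝ) (hε : 0 < ε) :
    ∫ u, {u : ℂ | ε ≤ ‖u‖}.indicator (fun u => S ζ (2 * m) m G (u, p)) u =
      ∫ u, {u : ℂ | ε ≤ ‖u‖}.indicator (fun u => G (u, p) / u ^ m) u := by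
  have hn : ‖ζ‖ = 1 := hζ.norm'_eq_one (by omega)
  have hζ0 : ζ ≠ 0 := by rintro rfl; simp at hn
  set F := {u : ℂ | ε ≤ ‖u‖}.indicator (fun u => G (u, p) / u ^ m) with hF
  have hFi : Integrable F := cut_integrable G hG.continuous hGc p m ε hε
  have hk : ∀ k : ℕ, ‖ζ ^ k‖ = 1 := by intro k; simp [hn]
  have hpt : ∀ u, {u : ℂ | ε ≤ ‖u‖}.indicator (fun u => S ζ (2 * m) m G (u, p)) u
      = ((2 * m : ℕ) : ℂ)⁻¹ * ∑ k ∈ Finset.range (2 * m), F (ζ ^ k * u) := by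
    intro u
    by_cases hu : ε ≤ ‖u‖
    · rw [Set.indicator_of_mem (by exact hu), S, Q, Finset.sum_div]
      congr 1
      refine Finset.sum_congr rfl fun k _ => ?_
      rw [hF, Set.indicator_of_mem (by simpa [hn] using hu)]
      have : (ζ ^ (-(m : ℤ))) ^ k = ((ζ ^ k) ^ m)⁻¹ := by
        rw [zpow_neg, zpow_natCast, inv_pow, ← pow_mul, ← pow_mul, mul_comm]
      simp only [this, mul_pow]
      rw [div_eq_mul_inv, div_eq_mul_inv, mul_inv]
      ring
    · rw [Set.indicator_of_notMem (by exact hu), Finset.sum_eq_zero, mul_zero]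
      intro k _
      rw [hF, Set.indicator_of_notMem (by simpa [hn] using hu)]
  simp_rw [hpt]
  rw [integral_const_mul, integral_finsetSum _ (fun k _ => rot_integrable _ (hk k) F hFi)]
  simp_rw [fun k => rot_int (ζ ^ k) (hk k) F]
  rw [Finset.sum_const, Finset.card_range, nsmul_eq_mul, inv_mul_cancel_left₀]
  exact_mod_cast (by omega : 2 * m ≠ 0)

lemma lim (ζ : ℂ) (m : ℕ) (hm : 1 ≤ m) (hζ : IsPrimitiveRoot ζ (2 * m)) (G : ℂ × ℂ → ℂ)
    (hG : ContDiff ℝ (⊤ : ℕ∞) G) (hGc : HasCompactSupport G) (p : ℂ) :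
    Tendsto (fun ε : ℝ => ∫ u, {u : ℂ | ε ≤ ‖u‖}.indicator (fun u => G (u, p) / u ^ m) u)
      (𝓝[>] (0 : ℝ)) (𝓝 (∫ u, S ζ (2 * m) m G (u, p))) := by
  have hi := S_int1 ζ m hm hζ G hG hGc p
  have : Tendsto (fun ε : ℝ => ∫ u, {u : ℂ | ε ≤ ‖u‖}.indicator
      (fun u => S ζ (2 * m) m G (u, p)) u)
      (𝓝[>] (0 : ℝ)) (𝓝 (∫ u, S ζ (2 * m) m G (u, p))) := by
    refine tendsto_integral_filter_of_dominated_convergence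
      (fun u => ‖S ζ (2 * m) m G (u, p)‖) ?_ ?_ hi.norm ?_
    · exact Eventually.of_forall fun ε => (hi.indicator (meas_set ε)).aestronglyMeasurable
    · exact Eventually.of_forall fun ε => ae_of_all _ fun u => norm_indicator_le_norm_self _ _
    · have h0 : ∀ᵐ u : ℂ, u ≠ 0 := by
        simp [ae_iff]
      filter_upwards [h0] with u hu
      refine tendsto_const_nhds.congr' ?_
      have : ∀ᶠ ε : ℝ in 𝓝[>] 0, ε < ‖u‖ :=
        nhdsWithin_le_nhds (eventually_lt_nhds (norm_pos_iff.2 hu))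
      filter_upwards [this] with ε hε
      rw [Set.indicator_of_mem (by exact hε.le)]
  refine this.congr' ?_
  filter_upwards [self_mem_nhdsWithin] with ε hε
  exact cut_eq ζ m hm hζ G hG hGc p ε hε

lemma slice_int2 (G : ℂ × ℂ → ℂ) (hG : Continuous G) (hGc : HasCompactSupport G) (u : ℂ) :
    Integrable (fun p => G (u, p)) := by
  refine Continuous.integrable_of_hasCompactSupport (by fun_prop) ?_
  refine HasCompactSupport.intro (hGc.isCompact.image continuous_snd) (fun p hp => ?_)
  apply image_eq_zero_of_notMem_tsupport
  exact fun h => hp ⟨_, h, rfl⟩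

lemma S_inner (ζ : ℂ) (N m : ℕ) (G : ℂ × ℂ → ℂ)
    (hG : Continuous G) (hGc : HasCompactSupport G) (u : ℂ) :
    ∫ p, S ζ N m G (u, p) = (N : ℂ)⁻¹ *
      ((∑ k ∈ Finset.range N, (ζ ^ (-(m : ℤ))) ^ k * ∫ p, G (ζ ^ k * u, p)) / u ^ m) := by
  simp only [S, Q]
  rw [integral_const_mul, integral_div, integral_finsetSum]
  · simp_rw [integral_const_mul]
  · intro k _
    exact (slice_int2 G hG hGc _).const_mul _

end RegFubini

open RegFubini in
/-- Fubini for regularized integrals, two-point configuration case: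
for `g : ℂ × ℂ → ℂ` smooth with compact support and `m ≥ 1`, the radial principal
values `h w` (in `z`) and `k z` (in `w`) of `g (z, w) / (z - w) ^ m` exist for every
`w` resp. `z`, the resulting functions are integrable, and their integrals agree. -/
theorem stmt_9 (g : ℂ × ℂ → ℂ) (hg : ContDiff ℝ (⊤ : ℕ∞) g) (hgc : HasCompactSupport g)
    (m : ℕ) (hm : 1 ≤ m) :
    ∃ h k : ℂ → ℂ,
      (∀ w : ℂ,
        Tendsto (fun ε : ℝ => ∫ z in {z : ℂ | ε ≤ ‖z - w‖}, g (z, w) / (z - w) ^ m)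
          (𝓝[>] (0 : ℝ)) (𝓝 (h w))) ∧
      (∀ z : ℂ,
        Tendsto (fun ε : ℝ => ∫ w in {w : ℂ | ε ≤ ‖z - w‖}, g (z, w) / (z - w) ^ m)
          (𝓝[>] (0 : ℝ)) (𝓝 (k z))) ∧
      Integrable h ∧ Integrable k ∧ ∫ w : ℂ, h w = ∫ z : ℂ, k z := by
  obtain ⟨ζ, hζ⟩ : ∃ ζ : ℂ, IsPrimitiveRoot ζ (2 * m) :=
    ⟨_, Complex.isPrimitiveRoot_exp (2 * m) (by omega)⟩
  set G1 : ℂ × ℂ → ℂ := fun q => g (q.1 + q.2, q.2) with hG1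
  set G2 : ℂ × ℂ → ℂ := fun q => g (q.2, q.2 - q.1) with hG2
  have s1 : ContDiff ℝ (⊤ : ℕ∞) G1 :=
    hg.comp ((contDiff_fst.add contDiff_snd).prodMk contDiff_snd)
  have s2 : ContDiff ℝ (⊤ : ℕ∞) G2 :=
    hg.comp (contDiff_snd.prodMk (contDiff_snd.sub contDiff_fst))
  have c1 : HasCompactSupport G1 := by
    refine HasCompactSupport.intro (hgc.isCompact.image
      (f := fun q : ℂ × ℂ => (q.1 - q.2, q.2)) (by fun_prop)) (fun q hq => ?_)
    refine image_eq_zero_of_notMem_tsupport (f := g) (x := (q.1 + q.2, q.2)) ?_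
    exact fun h => hq ⟨_, h, by simp⟩
  have c2 : HasCompactSupport G2 := by
    refine HasCompactSupport.intro (hgc.isCompact.image
      (f := fun q : ℂ × ℂ => (q.1 - q.2, q.1)) (by fun_prop)) (fun q hq => ?_)
    refine image_eq_zero_of_notMem_tsupport (f := g) (x := (q.2, q.2 - q.1)) ?_
    exact fun h => hq ⟨_, h, by simp⟩
  have i1 := S_int ζ m hm hζ G1 s1 c1
  have i2 := S_int ζ m hm hζ G2 s2 c2
  refine ⟨fun w => ∫ u, S ζ (2 * m) m G1 (u, w), fun z => ∫ u, S ζ (2 * m) m G2 (u, z),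
    fun w => ?_, fun z => ?_, i1.integral_prod_right, i2.integral_prod_right, ?_⟩
  · refine (lim ζ m hm hζ G1 s1 c1 w).congr fun ε => ?_
    have hms : MeasurableSet {z : ℂ | ε ≤ ‖z - w‖} :=
      measurableSet_le measurable_const (by fun_prop)
    rw [← integral_indicator hms, 
      ← integral_add_right_eq_self ({z : ℂ | ε ≤ ‖z - w‖}.indicator _) w]
    congr 1
    ext u
    simp [Set.indicator, hG1]
  · refine (lim ζ m hm hζ G2 s2 c2 z).congr fun ε => ?_
    have hms : MeasurableSet {w : ℂ | ε ≤ ‖z - w‖} :=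
      measurableSet_le measurable_const (by fun_prop)
    rw [← integral_indicator hms, ← integral_sub_left_eq_self _ volume z]
    congr 1
    ext u
    simp [Set.indicator, hG2]
  · have e1 := integral_integral_swap (f := fun u p => S ζ (2 * m) m G1 (u, p)) i1
    have e2 := integral_integral_swap (f := fun u p => S ζ (2 * m) m G2 (u, p)) i2
    rw [← e1, ← e2]
    congr 1
    ext u
    rw [S_inner ζ _ m G1 s1.continuous c1, S_inner ζ _ m G2 s2.continuous c2]
    congr 2
    refine Finset.sum_congr rfl fun k _ => ?_
    congr 1
    rw [← integral_add_right_eq_self (fun p => G2 (ζ ^ k * u, p)) (ζ ^ k * u)]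
    congr 1
    ext p
    simp [hG1, hG2, add_comm]
end
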